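/- Let (A_S,S) be an Artin-Tits system of spherical type and X ⊆ S. Then the quasi-centralizer decomposes as an internal semidirect product QZ_{A_S}(A_X) = QZ_{A_X}(A_X) ⋊ H_X: every g ∈ QZ_{A_S}(A_X) writes uniquely g = z·h with z ∈ QZ_{A_X}(A_X) = {a ∈ A_X : aX = Xa} and h ∈ H_X, and QZ_{A_X}(A_X) ∩ H_X = {1} with QZ_{A_X}(A_X) normal. -/

import Mathlib

/-!
Common definitions for formalizing "Normalisateur des sous-groupes paraboliques
des groupes d'Artin-Tits" (E. Godelle).

We fix a Coxeter matrix `M` over a finite index set `B` (Mathlib's convention: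
`M s t = 0` encodes `m_{s,t} = ∞`).  The Artin-Tits group `Artin M` is the
presented group on the braid relations, the Coxeter group is Mathlib's
`M.Group`, and `proj : Artin M →* M.Group` is the canonical projection
(adding the relations `s² = 1`).
-/

namespace ArtinTitsPaper

open List

variable {B : Type*}

/-- The alternating list `[s, t, s, t, ...]` with `n` terms, starting with `s`. -/
def altList (s t : B) : ℕ → List B
  | 0 => []
  | n + 1 => s :: altList t s n

/-- The braid relators `(sts⋯)(tst⋯)⁻¹` (`m_{s,t}` letters each) for `s ≠ t`,
`m_{s,t} ≠ ∞`. -/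
def braidRels (M : CoxeterMatrix B) : Set (FreeGroup B) :=
  { r | ∃ s t : B, s ≠ t ∧ M s t ≠ 0 ∧
      r = ((altList s t (M s t)).map FreeGroup.of).prod *
          (((altList t s (M s t)).map FreeGroup.of).prod)⁻¹ }

/-- The Artin-Tits group associated to the Coxeter matrix `M`. -/
def Artin (M : CoxeterMatrix B) : Type _ := PresentedGroup (braidRels M)

instance (M : CoxeterMatrix B) : Group (Artin M) :=
  QuotientGroup.Quotient.group _

/-- The standard generator of `Artin M` indexed by `s : B` (the image of `S` in `A_S`). -/
def gen (M : CoxeterMatrix B) (s : B) : Artin M := PresentedGroup.of s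

theorem altList_eq_reverse_alternatingWord (s t : B) (n : ℕ) :
    altList s t n = (CoxeterSystem.alternatingWord t s n).reverse := by
  induction n generalizing s t with
  | zero => rfl
  | succ n ih =>
      rw [altList, CoxeterSystem.alternatingWord_succ, List.concat_eq_append,
        List.reverse_append]
      simp [ih]

theorem lift_simple_listProd (M : CoxeterMatrix B) (l : List B) :
    FreeGroup.lift M.simple ((l.map FreeGroup.of).prod) =
      M.toCoxeterSystem.wordProd l := by
  rw [CoxeterSystem.wordProd, map_list_prod, List.map_map]
  simp [Function.comp_def, CoxeterMatrix.toCoxeterSystem_simple]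

theorem braid_lift (M : CoxeterMatrix B) :
    ∀ r ∈ braidRels M, FreeGroup.lift M.simple r = 1 := by
  rintro r ⟨s, t, hst, hm, rfl⟩
  rw [map_mul, map_inv, lift_simple_listProd, lift_simple_listProd,
    altList_eq_reverse_alternatingWord, altList_eq_reverse_alternatingWord,
    CoxeterSystem.wordProd_reverse, CoxeterSystem.wordProd_reverse]
  have hsym : M s t = M t s := M.symmetric s t
  have hb := M.toCoxeterSystem.wordProd_braidWord_eq t s
  rw [CoxeterSystem.braidWord, CoxeterSystem.braidWord, ← hsym] at hb
  rw [hb]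
  simp

/-- The canonical projection from the Artin-Tits group onto the Coxeter group
(adding the relations `s² = 1`). -/
def proj (M : CoxeterMatrix B) : Artin M →* M.Group :=
  PresentedGroup.toGroup (braid_lift M)

/-- The positive monoid `A_S⁺`, the submonoid of `A_S` generated by `S`. -/
def posMon (M : CoxeterMatrix B) : Submonoid (Artin M) :=
  Submonoid.closure (Set.range (gen M))

/-- The submonoid `A_X⁺` of `A_S` generated by `X ⊆ S`. -/
def posMonOn (M : CoxeterMatrix B) (X : Set B) : Submonoid (Artin M) :=
  Submonoid.closure (gen M '' X)

/-- The standard parabolic subgroup `A_X` of `A_S` generated by `X ⊆ S`. -/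
def stdSub (M : CoxeterMatrix B) (X : Set B) : Subgroup (Artin M) :=
  Subgroup.closure (gen M '' X)

/-- The standard parabolic subgroup `W_X` of the Coxeter group `W_S`. -/
def coxSub (M : CoxeterMatrix B) (X : Set B) : Subgroup M.Group :=
  Subgroup.closure (M.simple '' X)

/-- `X ⊆ S` is of spherical type if the Coxeter group `W_X` is finite. -/
def IsSpherical (M : CoxeterMatrix B) (X : Set B) : Prop :=
  Finite (coxSub M X)

/-- `a` left-divides `b` in the positive monoid: `b = a c` with `c ∈ A_S⁺`. -/
def ldvd (M : CoxeterMatrix B) (a b : Artin M) : Prop :=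
  ∃ c ∈ posMon M, a * c = b

/-- `a` right-divides `b` in the positive monoid: `b = c a` with `c ∈ A_S⁺`. -/
def rdvd (M : CoxeterMatrix B) (a b : Artin M) : Prop :=
  ∃ c ∈ posMon M, c * a = b

/-- `d` is the least common multiple `Δ_X` of `X` in `A_X⁺` (for left-divisibility). -/
def IsDelta (M : CoxeterMatrix B) (X : Set B) (d : Artin M) : Prop :=
  d ∈ posMonOn M X ∧
  (∀ s ∈ X, ∃ c ∈ posMonOn M X, gen M s * c = d) ∧
  ∀ m ∈ posMonOn M X, (∀ s ∈ X, ∃ c ∈ posMonOn M X, gen M s * c = m) →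
    ∃ c ∈ posMonOn M X, d * c = m

/-- The subset `Xg = {σ_x g : x ∈ X}` of `A_S`. -/
def leftMul (M : CoxeterMatrix B) (X : Set B) (g : Artin M) : Set (Artin M) :=
  (fun x => gen M x * g) '' X

/-- The subset `gX = {g σ_x : x ∈ X}` of `A_S`. -/
def rightMul (M : CoxeterMatrix B) (X : Set B) (g : Artin M) : Set (Artin M) :=
  (fun x => g * gen M x) '' X

/-- `Conj(S;X,Y) = {g ∈ A_S : gX = Yg}`. -/
def conjSet (M : CoxeterMatrix B) (X Y : Set B) : Set (Artin M) :=
  { g | rightMul M X g = leftMul M Y g }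

/-- `Conj⁺(S;X,Y) = {g ∈ A_S⁺ : gX = Yg}`. -/
def conjPos (M : CoxeterMatrix B) (X Y : Set B) : Set (Artin M) :=
  { g | g ∈ posMon M ∧ rightMul M X g = leftMul M Y g }

/-- The quasi-centralizer `QZ_{A_S}(A_X) = {g ∈ A_S : gX = Xg}`. -/
def QZset (M : CoxeterMatrix B) (X : Set B) : Set (Artin M) :=
  conjSet M X X

/-- The indecomposable component of `Z` containing `t` (vertices of `Z` joined to `t`
by a path of edges `m_{a,b} ≠ 2` in the Coxeter diagram on `Z`). -/
def comp (M : CoxeterMatrix B) (Z : Set B) (t : B) : Set B :=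
  { s ∈ Z | Relation.ReflTransGen (fun a b => a ∈ Z ∧ b ∈ Z ∧ a ≠ b ∧ M a b ≠ 2) t s }

/-- `Z` is indecomposable: it admits no nontrivial partition `Z = Z₁ ∪ Z₂` with
`m_{a,b} = 2` for `a ∈ Z₁`, `b ∈ Z₂`. -/
def Indecomp (M : CoxeterMatrix B) (Z : Set B) : Prop :=
  ¬ ∃ Z₁ Z₂ : Set B, Z₁.Nonempty ∧ Z₂.Nonempty ∧ Z₁ ∪ Z₂ = Z ∧ Disjoint Z₁ Z₂ ∧
      ∀ a ∈ Z₁, ∀ b ∈ Z₂, M a b = 2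

/-- `g` is an elementary positive `Y`-ribbon-`X`: `g = d_{X,t}` for some `t ∈ S` with
`X(t)` of spherical type, where `d_{X,t} = Δ_{X(t)}` if `t ∈ X` and
`d_{X,t} = Δ_{X(t)} Δ_{X(t)∖{t}}⁻¹` otherwise, and `Y ⊆ X ∪ {t}` satisfies `Yg = gX`. -/
def IsElemRibbon (M : CoxeterMatrix B) (X Y : Set B) (g : Artin M) : Prop :=
  ∃ t : B, IsSpherical M (comp M (X ∪ {t}) t) ∧
    ((t ∈ X ∧ IsDelta M (comp M (X ∪ {t}) t) g) ∨
      (t ∉ X ∧ ∃ d₁ d₂ : Artin M, IsDelta M (comp M (X ∪ {t}) t) d₁ ∧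
        IsDelta M ((comp M (X ∪ {t}) t) \ {t}) d₂ ∧ g = d₁ * d₂⁻¹)) ∧
    Y ⊆ X ∪ {t} ∧ leftMul M Y g = rightMul M X g

/-- `g` is a positive `Y`-ribbon-`X`: a product `g = g_n ⋯ g_1` of elementary positive
`X_i`-ribbons-`X_{i-1}` with `X_0 = X`, `X_n = Y`. -/
inductive IsRibbon (M : CoxeterMatrix B) : Set B → Set B → Artin M → Prop
  | nil (X : Set B) : IsRibbon M X X 1
  | cons {X Y Z : Set B} {g h : Artin M} :
      IsRibbon M X Y g → IsElemRibbon M Y Z h → IsRibbon M X Z (h * g)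

/-- `g` is `X`-reduced: no element of `X` left-divides `g`. -/
def lreduced (M : CoxeterMatrix B) (X : Set B) (g : Artin M) : Prop :=
  ∀ s ∈ X, ¬ ldvd M (gen M s) g

/-- `g` is reduced-`X`: no element of `X` right-divides `g`. -/
def rreduced (M : CoxeterMatrix B) (X : Set B) (g : Artin M) : Prop :=
  ∀ s ∈ X, ¬ rdvd M (gen M s) g

/-- The set `H_X` of elements `g₁ g₂⁻¹` where `g₁, g₂` are `X`-reduced positive
`X`-ribbons-`X`. -/
def HXset (M : CoxeterMatrix B) (X : Set B) : Set (Artin M) :=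
  { g | ∃ g₁ g₂ : Artin M, IsRibbon M X X g₁ ∧ lreduced M X g₁ ∧
      IsRibbon M X X g₂ ∧ lreduced M X g₂ ∧ g = g₁ * g₂⁻¹ }

/-- The length of a positive element (the common length of its expressions as words
in the generators; junk value `0` outside of `A_S⁺`). -/
noncomputable def len (M : CoxeterMatrix B) (g : Artin M) : ℕ :=
  sInf { n | ∃ l : List B, l.length = n ∧ (l.map (gen M)).prod = g }

/-- The length of an element of the Coxeter group `W_S`. -/
noncomputable def wlen (M : CoxeterMatrix B) (w : M.Group) : ℕ :=
  sInf { n | ∃ l : List B, l.length = n ∧ (l.map M.simple).prod = w }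

/-- `g ∈ A_{S,red}`: `g` is positive and has the same length as its image in `W_S`. -/
def Red (M : CoxeterMatrix B) (g : Artin M) : Prop :=
  g ∈ posMon M ∧ len M g = wlen M (proj M g)

/-- `C` is a simple `s`-chain-`u`: either `C = 1` and `s = u`, or
`C = tst⋯` (`k` letters, `k < m_{s,t}`) with `u ∈ {s,t}` and `C·u = tst⋯` (`k+1` letters). -/
def IsSimpleChain (M : CoxeterMatrix B) (s u : B) (C : Artin M) : Prop :=
  (C = 1 ∧ s = u) ∨
  ∃ t : B, t ≠ s ∧ (u = s ∨ u = t) ∧ ∃ k : ℕ,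
    (M s t = 0 ∨ k < M s t) ∧
    C = ((altList t s k).map (gen M)).prod ∧
    C * gen M u = ((altList t s (k + 1)).map (gen M)).prod

/-- `C` is an `s`-chain-`t`: a product `C₁ ⋯ C_k` of simple chains composing from
origin `s` to target `t`. -/
inductive IsChain (M : CoxeterMatrix B) : B → B → Artin M → Prop
  | single {s u : B} {C : Artin M} : IsSimpleChain M s u C → IsChain M s u C
  | comp {s u v : B} {C D : Artin M} :
      IsChain M s u C → IsSimpleChain M u v D → IsChain M s v (C * D)

section ReflectionRepresentation

open Real Polynomial.Chebyshev Module

/-- Twice the cosine form of the Coxeter matrix: `-2 cos (π / m)` (and `-2` when `m = 0`). -/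
noncomputable def cosForm (M : CoxeterMatrix B) (s t : B) : ℝ :=
  -2 * cos (π / (M s t : ℝ))

theorem cosForm_self (M : CoxeterMatrix B) (s : B) : cosForm M s s = 2 := by
  simp [cosForm]

theorem cosForm_comm (M : CoxeterMatrix B) (s t : B) : cosForm M s t = cosForm M t s := by
  simp [cosForm, M.symmetric s t]

/-- The linear form `v ↦ 2 B(e_s, v)` on the space of the geometric representation. -/
noncomputable def cosDual (M : CoxeterMatrix B) (s : B) : Dual ℝ (B →₀ ℝ) :=
  Finsupp.linearCombination ℝ (cosForm M s)

theorem cosDual_single (M : CoxeterMatrix B) (s t : B) :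
    cosDual M s (Finsupp.single t 1) = cosForm M s t := by
  simp [cosDual]

theorem cosDual_self (M : CoxeterMatrix B) (s : B) :
    cosDual M s (Finsupp.single s 1) = 2 := by
  rw [cosDual_single, cosForm_self]

/-- The reflection attached to `s` in the geometric representation. -/
noncomputable def geomRefl (M : CoxeterMatrix B) (s : B) : (B →₀ ℝ) ≃ₗ[ℝ] (B →₀ ℝ) :=
  reflection (cosDual_self M s)

theorem cosForm_mul_sub_two (M : CoxeterMatrix B) (s t : B) :
    cosDual M s (Finsupp.single t 1) * cosDual M t (Finsupp.single s 1) - 2 =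
      2 * cos (2 * π / (M s t : ℝ)) := by
  rw [cosDual_single, cosDual_single, cosForm_comm M t s, cosForm, mul_div_assoc, cos_two_mul]
  ring

theorem sin_two_pi_div_pos {m : ℕ} (hm : 3 ≤ m) : 0 < sin (2 * π / (m : ℝ)) := by
  have hm' : (3 : ℝ) ≤ m := by exact_mod_cast hm
  apply sin_pos_of_pos_of_lt_pi
  · have := pi_pos
    positivity
  · rw [div_lt_iff₀ (by linarith)]
    nlinarith [pi_pos]

theorem geomRefl_isLiftable (M : CoxeterMatrix B) : M.IsLiftable (geomRefl M) := by
  intro s t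
  by_cases hst : s = t
  · subst hst
    rw [M.diagonal, pow_one]
    ext1 v
    exact involutive_reflection (cosDual_self M s) v
  have h1 := M.off_diagonal s t hst
  ext1 z
  have key := reflection_mul_reflection_pow_apply (cosDual_self M s) (cosDual_self M t)
    (M s t) z _ (cosForm_mul_sub_two M s t).symm
  change ((reflection (cosDual_self M s) * reflection (cosDual_self M t)) ^ M s t) z = z
  rw [key]
  obtain h0 | h2 | h3 : M s t = 0 ∨ M s t = 2 ∨ 3 ≤ M s t := by omega
  · simp [h0]
  · have e1 : cosDual M t (Finsupp.single s 1) = 0 := by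
      rw [cosDual_single, cosForm_comm, cosForm, h2]; simp
    have e2 : cosDual M s (Finsupp.single t 1) = 0 := by
      rw [cosDual_single, cosForm, h2]; simp
    rw [e1, e2, h2]
    norm_num
    abel
  · have hs := sin_two_pi_div_pos h3
    have hS := fun n : ℤ => S_two_mul_real_cos (2 * π / (M s t : ℝ)) n
    have hm0 : (M s t : ℝ) ≠ 0 := by
      have : 0 < M s t := by omega
      positivity
    set θ := 2 * π / (M s t : ℝ) with hθ
    have hmθ : (M s t : ℝ) * θ = 2 * π := by rw [hθ]; field_simp
    obtain ⟨k, hk | hk⟩ := Nat.even_or_odd' (M s t)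
    · have hz : (S ℝ ((((M s t : ℕ) : ℤ) - 2) / 2)).eval (2 * cos θ) = 0 := by
        have : (((M s t : ℕ) : ℤ) - 2) / 2 = (k : ℤ) - 1 := by omega
        rw [this]
        have h := hS ((k : ℤ) - 1)
        have h' : (((k : ℤ) - 1 : ℤ) + 1 : ℝ) * θ = π := by
          rw [hk] at hmθ
          push_cast at hmθ ⊢
          linarith
        rw [h', sin_pi] at h
        exact (mul_eq_zero.1 h).resolve_right hs.ne'
      have hz' : (S ℝ ((((M s t : ℕ) : ℤ) - 1) / 2)).eval (2 * cos θ) = 0 := by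
        have : (((M s t : ℕ) : ℤ) - 1) / 2 = (((M s t : ℕ) : ℤ) - 2) / 2 := by omega
        rw [this, hz]
      rw [hz, hz']
      simp
    · have hz : (S ℝ (k : ℤ)).eval (2 * cos θ) + (S ℝ ((k : ℤ) - 1)).eval (2 * cos θ) = 0 := by
        have h := hS (k : ℤ)
        have h' := hS ((k : ℤ) - 1)
        have e : ((k : ℤ) + 1 : ℝ) * θ = 2 * π - (((k : ℤ) - 1 : ℤ) + 1 : ℝ) * θ := by
          rw [hk] at hmθ
          push_cast at hmθ ⊢
          linarith
        rw [e, sin_two_pi_sub] at h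
        have : ((S ℝ (k : ℤ)).eval (2 * cos θ) + (S ℝ ((k : ℤ) - 1)).eval (2 * cos θ)) * sin θ
            = 0 := by rw [add_mul, h, h']; ring
        exact (mul_eq_zero.1 this).resolve_right hs.ne'
      have i1 : (((M s t : ℕ) : ℤ) - 1) / 2 = (k : ℤ) := by omega
      have i2 : (((M s t : ℕ) : ℤ) - 2) / 2 = (k : ℤ) - 1 := by omega
      have i3 : (((M s t : ℕ) : ℤ) - 3) / 2 = (k : ℤ) - 1 := by omega
      have i4 : ((M s t : ℕ) : ℤ) / 2 = (k : ℤ) := by omega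
      rw [i1, i2, i3, i4, hz]
      simp

/-- In the Coxeter group of `M`, the order of `s t` is exactly `M s t`. -/
theorem dvd_of_simple_mul_simple_pow_eq_one (M : CoxeterMatrix B) {s t : B} (hst : s ≠ t) {j : ℕ}
    (h : (M.toCoxeterSystem.simple s * M.toCoxeterSystem.simple t) ^ j = 1) : M s t ∣ j := by
  have h1 := M.off_diagonal s t hst
  have hr : (geomRefl M s * geomRefl M t) ^ j = 1 := by
    have := congrArg (M.toCoxeterSystem.lift ⟨_, geomRefl_isLiftable M⟩) h
    rw [map_pow, map_mul, map_one, CoxeterSystem.lift_apply_simple,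
      CoxeterSystem.lift_apply_simple] at this
    exact this
  have key := reflection_mul_reflection_pow_apply_self (cosDual_self M s) (cosDual_self M t)
    j _ (cosForm_mul_sub_two M s t).symm
  change ((geomRefl M s * geomRefl M t) ^ j) _ = _ at key
  rw [hr] at key
  simp only [cosDual_single] at key
  have ks := DFunLike.congr_fun key s
  have kt := DFunLike.congr_fun key t
  simp [hst, Ne.symm hst] at ks kt
  obtain h0 | h2 | h3 : M s t = 0 ∨ M s t = 2 ∨ 3 ≤ M s t := by omega
  · rw [h0] at kt
    simp [S_eval_two, cosForm, M.symmetric t s, h0] at kt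
    simp [h0, kt]
  · rw [h2]
    rw [h2] at ks
    have e : (2 : ℝ) * π / ((2 : ℕ) : ℝ) = π := by push_cast; field_simp
    rw [e, cos_pi, mul_neg, mul_one, S_eval_neg_two, S_eval_neg_two] at ks
    obtain he | ho := Nat.even_or_odd j
    · exact he.two_dvd
    · have : ((j : ℤ)).negOnePow = -1 := Int.negOnePow_odd _ (by exact_mod_cast ho)
      rw [Int.negOnePow_sub, this] at ks
      push_cast at ks
      norm_num at ks
  · have hs := sin_two_pi_div_pos h3
    have hS := fun n : ℤ => S_two_mul_real_cos (2 * π / (M s t : ℝ)) n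
    have hm0 : (0 : ℝ) < (M s t : ℝ) := by
      have : 0 < M s t := by omega
      positivity
    have hc : cosForm M t s ≠ 0 := by
      rw [cosForm_comm, cosForm]
      have : 0 < cos (π / (M s t : ℝ)) := by
        apply cos_pos_of_mem_Ioo
        have h3' : (3 : ℝ) ≤ M s t := by exact_mod_cast h3
        constructor
        · have : 0 < π / (M s t : ℝ) := by have := pi_pos; positivity
          linarith [pi_pos]
        · rw [div_lt_div_iff₀ hm0 (by norm_num)]
          nlinarith [pi_pos]
      nlinarith
    have z : (S ℝ ((j : ℤ) - 1)).eval (2 * cos (2 * π / (M s t : ℝ))) = 0 := by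
      rcases kt with kt | kt
      · exact kt
      · exact absurd kt hc
    rw [z, add_zero] at ks
    have a1 := hS ((j : ℤ) - 1)
    have a2 := hS (j : ℤ)
    rw [z, zero_mul] at a1
    rw [← ks, one_mul] at a2
    push_cast at a1 a2
    rw [sub_add_cancel] at a1
    rw [add_mul, one_mul, sin_add, ← a1, zero_mul, zero_add] at a2
    have hcos : cos ((j : ℝ) * (2 * π / (M s t : ℝ))) = 1 := by
      have : (cos ((j : ℝ) * (2 * π / (M s t : ℝ))) - 1) * sin (2 * π / (M s t : ℝ)) = 0 := by
        linarith
      have := (mul_eq_zero.1 this).resolve_right hs.ne'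
      linarith
    obtain ⟨n, hn⟩ := (cos_eq_one_iff _).1 hcos
    have : ((j : ℤ) : ℝ) = ((M s t : ℤ) : ℝ) * (n : ℝ) := by
      have := pi_pos
      push_cast
      field_simp at hn
      linarith
    have : (j : ℤ) = (M s t : ℤ) * n := by exact_mod_cast this
    exact Int.natCast_dvd_natCast.1 ⟨n, this⟩

end ReflectionRepresentation

section Exchange

variable {M : CoxeterMatrix B} {W : Type*} [Group W] (cs : CoxeterSystem M W)

theorem end_mul_apply {α : Type*} (f g : Function.End α) (x : α) : (f * g) x = f (g x) := rfl

theorem end_one_apply {α : Type*} (x : α) : (1 : Function.End α) x = x := rfl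

open Classical in
/-- The action of a simple reflection on (reflections) × `ZMod 2`. -/
noncomputable def reflAct (i : B) : Function.End (W × ZMod 2) := fun p =>
  (cs.simple i * p.1 * cs.simple i, p.2 + if p.1 = cs.simple i then 1 else 0)

open Classical in
theorem reflAct_mul_pow (i j : B) (k : ℕ) (p : W × ZMod 2) :
    ((reflAct cs i * reflAct cs j) ^ k) p =
      ((cs.simple i * cs.simple j) ^ k * p.1 * ((cs.simple i * cs.simple j) ^ k)⁻¹,
        p.2 + ∑ l ∈ Finset.range (2 * k),
          if p.1 = cs.simple j * (cs.simple i * cs.simple j) ^ l then 1 else 0) := by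
  induction k with
  | zero => simp [end_one_apply]
  | succ k ih =>
    rw [pow_succ', end_mul_apply, ih, end_mul_apply, mul_add, mul_one,
      Finset.sum_range_succ, Finset.sum_range_succ,
      ← add_assoc, ← add_assoc]
    have hj : (cs.simple j)⁻¹ = cs.simple j := cs.inv_simple j
    have hi : (cs.simple i)⁻¹ = cs.simple i := cs.inv_simple i
    have sq : cs.simple j * cs.simple j = 1 := cs.simple_mul_simple_self j
    have sqi : cs.simple i * cs.simple i = 1 := cs.simple_mul_simple_self i
    set c := cs.simple i * cs.simple j with hc
    have hcj : ∀ n : ℕ, (c ^ n)⁻¹ * cs.simple j = cs.simple j * c ^ n := by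
      intro n
      have e : cs.simple j * c * (cs.simple j)⁻¹ = c⁻¹ := by
        rw [hc, mul_inv_rev, hi, hj]
        simp only [mul_assoc, sq, mul_one]
      rw [← inv_pow, ← e, conj_pow, hj, mul_assoc, sq, mul_one]
    have e1 : c ^ k * p.1 * (c ^ k)⁻¹ = cs.simple j ↔ p.1 = cs.simple j * c ^ (2 * k) := by
      rw [mul_inv_eq_iff_eq_mul, ← eq_inv_mul_iff_mul_eq, ← mul_assoc, hcj, mul_assoc,
        ← pow_add, two_mul]
    have e2 : cs.simple j * (c ^ k * p.1 * (c ^ k)⁻¹) * cs.simple j = cs.simple i ↔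
        p.1 = cs.simple j * c ^ (2 * k + 1) := by
      have : cs.simple j * (c ^ k * p.1 * (c ^ k)⁻¹) * cs.simple j = cs.simple i ↔
          c ^ k * p.1 * (c ^ k)⁻¹ = cs.simple j * c := by
        rw [← eq_mul_inv_iff_mul_eq, ← eq_inv_mul_iff_mul_eq, hj]
      rw [this, mul_inv_eq_iff_eq_mul, ← eq_inv_mul_iff_mul_eq, ← mul_assoc, ← mul_assoc, hcj,
        mul_assoc, mul_assoc, ← pow_succ', ← pow_add]
      congr! 3
      ring
    simp only [reflAct, e1, e2]
    refine Prod.ext ?_ rfl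
    simp only [pow_succ', mul_inv_rev, mul_assoc, hc, hi, hj]

theorem reflAct_isLiftable : M.IsLiftable (reflAct cs) := by
  classical
  intro i j
  funext p
  rw [reflAct_mul_pow, cs.simple_mul_simple_pow, two_mul, Finset.sum_range_add]
  simp only [pow_add, cs.simple_mul_simple_pow, one_mul]
  rw [CharTwo.add_self_eq_zero]
  simp [end_one_apply]

open Classical in
theorem lift_reflAct_wordProd (ω : List B) (p : W × ZMod 2) :
    cs.lift ⟨_, reflAct_isLiftable cs⟩ (cs.wordProd ω) p =
      (cs.wordProd ω * p.1 * (cs.wordProd ω)⁻¹, p.2 + ((cs.rightInvSeq ω).count p.1 : ZMod 2)) := by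
  induction ω with
  | nil => simp [end_one_apply]
  | cons i ω ih =>
    rw [cs.wordProd_cons, map_mul, cs.lift_apply_simple, end_mul_apply, ih]
    simp only [reflAct, CoxeterSystem.rightInvSeq, List.count_cons]
    refine Prod.ext ?_ ?_
    · simp [mul_assoc]
    · have : cs.wordProd ω * p.1 * (cs.wordProd ω)⁻¹ = cs.simple i ↔
          (cs.wordProd ω)⁻¹ * cs.simple i * cs.wordProd ω = p.1 := by
        rw [mul_inv_eq_iff_eq_mul, mul_assoc, inv_mul_eq_iff_eq_mul, eq_comm]
      simp [this, add_assoc]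

/-- The exchange condition. -/
theorem simple_mem_rightInvSeq {ω : List B} {i : B} (h : cs.IsRightDescent (cs.wordProd ω) i) :
    cs.simple i ∈ cs.rightInvSeq ω := by
  classical
  obtain ⟨ω', hω', e⟩ := cs.exists_isReduced (cs.wordProd ω * cs.simple i)
  have hred : cs.IsReduced (ω'.concat i) := by
    rw [CoxeterSystem.IsReduced, cs.wordProd_concat, ← e, cs.simple_mul_simple_cancel_right,
      List.length_concat, ← hω', ← e, cs.isRightDescent_iff.1 h]
  have hprod : cs.wordProd (ω'.concat i) = cs.wordProd ω := by
    rw [cs.wordProd_concat, ← e, cs.simple_mul_simple_cancel_right]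
  have h1 := lift_reflAct_wordProd cs ω (cs.simple i, 0)
  rw [← hprod, lift_reflAct_wordProd] at h1
  have h2 := (Prod.ext_iff.1 h1).2
  have hmem : cs.simple i ∈ cs.rightInvSeq (ω'.concat i) := by
    rw [cs.rightInvSeq_concat]; simp
  simp only [zero_add, List.count_eq_one_of_mem hred.nodup_rightInvSeq hmem] at h2
  by_contra hn
  rw [List.count_eq_zero_of_not_mem hn] at h2
  simp at h2

theorem simple_mem_leftInvSeq {ω : List B} {i : B} (h : cs.IsLeftDescent (cs.wordProd ω) i) :
    cs.simple i ∈ cs.leftInvSeq ω := by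
  rw [← List.reverse_reverse ω, cs.leftInvSeq_reverse, List.mem_reverse]
  apply simple_mem_rightInvSeq
  rwa [cs.wordProd_reverse, cs.isRightDescent_inv_iff]

theorem leftInvSeq_append (ω ω' : List B) :
    cs.leftInvSeq (ω ++ ω') = cs.leftInvSeq ω ++
      (cs.leftInvSeq ω').map (fun r => cs.wordProd ω * r * (cs.wordProd ω)⁻¹) := by
  induction ω with
  | nil => simp
  | cons i ω ih =>
    simp [CoxeterSystem.leftInvSeq, ih, cs.wordProd_cons, Function.comp_def, mul_assoc]

/-- If `s` is an inversion of the second factor then a letter of it can be deleted. -/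
theorem exists_of_mem_leftInvSeq {ω : List B} {r : W} (h : r ∈ cs.leftInvSeq ω) :
    ∃ ω' : List B, ω'.length + 1 = ω.length ∧ r * cs.wordProd ω = cs.wordProd ω' := by
  obtain ⟨j, hj, rfl⟩ := List.mem_iff_getElem.1 h
  have hj' : j < ω.length := by simpa using hj
  refine ⟨ω.eraseIdx j, ?_, ?_⟩
  · rw [List.length_eraseIdx_of_lt hj']; omega
  · rw [← cs.getD_leftInvSeq_mul_wordProd, List.getD_eq_getElem _ _ hj]

theorem length_altList (s t : B) (n : ℕ) : (altList s t n).length = n := by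
  induction n generalizing s t with
  | zero => rfl
  | succ n ih => simp [altList, ih]

theorem exists_of_mem_leftInvSeq_altList {s t : B} {k : ℕ} {r : W}
    (h : r ∈ cs.leftInvSeq (altList s t k)) :
    ∃ j < k, r = (cs.simple s * cs.simple t) ^ j * cs.simple s := by
  induction k generalizing s t r with
  | zero => simp [altList] at h
  | succ k ih =>
    simp only [altList, CoxeterSystem.leftInvSeq, List.mem_cons, List.mem_map] at h
    obtain rfl | ⟨r', hr', rfl⟩ := h
    · exact ⟨0, by omega, by simp⟩
    · obtain ⟨j, hj, rfl⟩ := ih hr'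
      refine ⟨j + 1, by omega, ?_⟩
      rw [MulAut.conj_apply, cs.inv_simple, ← mul_assoc]
      congr 1
      have : ∀ n : ℕ, cs.simple s * (cs.simple t * cs.simple s) ^ n * cs.simple t =
          (cs.simple s * cs.simple t) ^ (n + 1) := by
        intro n
        induction n with
        | zero => simp
        | succ n ihn => rw [pow_succ (cs.simple s * cs.simple t), ← ihn, pow_succ]
                        simp only [mul_assoc]
      exact this j

end Exchange

section Dihedral

variable (M : CoxeterMatrix B)

local notation "cs" => CoxeterMatrix.toCoxeterSystem M

theorem matrix_ne_zero [Finite M.Group] (s t : B) : M s t ≠ 0 := by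
  intro h0
  have hst : s ≠ t := by
    rintro rfl
    simp at h0
  obtain ⟨n, hn, h⟩ := (isOfFinOrder_iff_pow_eq_one.1
    (isOfFinOrder_of_finite ((cs).simple s * (cs).simple t)))
  have := dvd_of_simple_mul_simple_pow_eq_one M hst h
  rw [h0, zero_dvd_iff] at this
  omega

/-- If `s ≠ t` are left descents of `w`, a reduced word of `w` begins with the longest
alternating word in `s` and `t`. -/
theorem exists_altList_append_of_isLeftDescent {s t : B} (hst : s ≠ t) {w : M.Group}
    (hs : (cs).IsLeftDescent w s) (ht : (cs).IsLeftDescent w t) {k : ℕ} (hk : k ≤ M s t) :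
    (∃ ω : List B, w = (cs).wordProd (altList s t k ++ ω) ∧ (cs).length w = k + ω.length) ∧
    (∃ ω : List B, w = (cs).wordProd (altList t s k ++ ω) ∧ (cs).length w = k + ω.length) := by
  induction k with
  | zero =>
    obtain ⟨ω, h1, h2⟩ := (cs).exists_isReduced w
    have : w = (cs).wordProd ([] ++ ω) ∧ (cs).length w = 0 + ω.length :=
      ⟨by simpa using h2, by rw [h2, h1.eq, zero_add]⟩
    exact ⟨⟨ω, this⟩, ⟨ω, this⟩⟩
  | succ k ih =>
    have step : ∀ a b : B, a ≠ b → (cs).IsLeftDescent w a → k + 1 ≤ M a b →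
        (∃ ω : List B, w = (cs).wordProd (altList b a k ++ ω) ∧ (cs).length w = k + ω.length) →
        (∃ ω : List B, w = (cs).wordProd (altList a b (k + 1) ++ ω) ∧
          (cs).length w = (k + 1) + ω.length) := by
      rintro a b hab ha hk ⟨ω, e, hl⟩
      have hmem := simple_mem_leftInvSeq (cs) (e ▸ ha)
      rw [leftInvSeq_append, List.mem_append, List.mem_map] at hmem
      rcases hmem with hmem | ⟨r, hr, hr'⟩
      · exfalso
        obtain ⟨j, hj, e'⟩ := exists_of_mem_leftInvSeq_altList (cs) hmem
        have : ((cs).simple b * (cs).simple a) ^ (j + 1) = 1 := by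
          rw [pow_succ, ← mul_assoc, ← e', (cs).simple_mul_simple_self]
        have hd := Nat.le_of_dvd (by omega)
          (dvd_of_simple_mul_simple_pow_eq_one M (Ne.symm hab) this)
        rw [M.symmetric] at hd
        omega
      · obtain ⟨ω', hω', e'⟩ := exists_of_mem_leftInvSeq (cs) hr
        refine ⟨ω', ?_, by omega⟩
        rw [altList, List.cons_append, (cs).wordProd_cons, (cs).wordProd_append, ← e',
          ← hr', e, (cs).wordProd_append]
        simp only [mul_assoc, inv_mul_cancel_left]
        rw [← mul_assoc r, ((cs).isReflection_of_mem_leftInvSeq ω hr).mul_self, one_mul]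
    exact ⟨step s t hst hs hk (ih (by omega)).2,
      step t s (Ne.symm hst) ht (by rwa [M.symmetric]) (ih (by omega)).1⟩

theorem altList_add (s t : B) (k l : ℕ) :
    ∃ a b : B, ((a = s ∧ b = t) ∨ (a = t ∧ b = s)) ∧
      altList s t (k + l) = altList s t k ++ altList a b l := by
  induction k generalizing s t with
  | zero => exact ⟨s, t, .inl ⟨rfl, rfl⟩, by simp [altList]⟩
  | succ k ih =>
    obtain ⟨a, b, h, e⟩ := ih t s
    refine ⟨a, b, h.symm, ?_⟩
    rw [Nat.add_right_comm, altList, e, altList, List.cons_append]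

theorem length_altList_mul {s t : B} (hst : s ≠ t) {w : M.Group}
    (hs : ¬ (cs).IsLeftDescent w s) (ht : ¬ (cs).IsLeftDescent w t) {k : ℕ} (hk : k ≤ M s t) :
    (cs).length ((cs).wordProd (altList s t k) * w) = k + (cs).length w := by
  induction k using Nat.strong_induction_on generalizing s t with
  | _ k ih =>
  match k with
  | 0 => simp [altList]
  | 1 =>
    rw [altList, altList, (cs).wordProd_singleton, (cs).not_isLeftDescent_iff.1 hs, add_comm]
  | k + 2 =>
    have hk' : k + 2 ≤ M t s := by rwa [M.symmetric]
    have ih1 := ih (k + 1) (by omega) (Ne.symm hst) ht hs (by omega)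
    have ih0 := ih k (by omega) hst hs ht (by omega)
    rw [altList, (cs).wordProd_cons, mul_assoc]
    rcases (cs).length_simple_mul ((cs).wordProd (altList t s (k + 1)) * w) s with h | h
    · rw [h, ih1]; omega
    · exfalso
      have ds : (cs).IsLeftDescent ((cs).wordProd (altList t s (k + 1)) * w) s := by
        rw [(cs).isLeftDescent_iff, h]
      have dt : (cs).IsLeftDescent ((cs).wordProd (altList t s (k + 1)) * w) t := by
        rw [CoxeterSystem.IsLeftDescent, ih1, altList, (cs).wordProd_cons, mul_assoc,
          (cs).simple_mul_simple_cancel_left, ih0]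
        omega
      obtain ⟨ω, e, hl⟩ := (exists_altList_append_of_isLeftDescent M (Ne.symm hst) dt ds
        (k := k + 2) hk').1
      obtain ⟨a, b, hab, e2⟩ := altList_add t s (k + 1) 1
      rw [e2, List.append_assoc, (cs).wordProd_append] at e
      have e3 := mul_left_cancel e
      have : (cs).IsLeftDescent w a := by
        rw [CoxeterSystem.IsLeftDescent, e3]
        simp only [altList, List.singleton_append, (cs).wordProd_cons,
          (cs).simple_mul_simple_cancel_left]
        rw [← (cs).wordProd_cons, show a :: ω = altList a b 1 ++ ω by rfl, ← e3]
        have := (cs).length_wordProd_le ω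
        rw [ih1] at hl
        omega
      rcases hab with ⟨rfl, rfl⟩ | ⟨rfl, rfl⟩ <;> contradiction

end Dihedral

section Monoid

variable (M : CoxeterMatrix B)

local notation "cs" => CoxeterMatrix.toCoxeterSystem M

/-- The braid relations on the free monoid. -/
def braidRel (a b : FreeMonoid B) : Prop :=
  ∃ s t : B, s ≠ t ∧ M s t ≠ 0 ∧ a = FreeMonoid.ofList (altList s t (M s t)) ∧
    b = FreeMonoid.ofList (altList t s (M s t))

/-- The abstract positive braid monoid, presented by the braid relations. -/
abbrev Mon : Type _ := PresentedMonoid (braidRel M)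

/-- The element of the braid monoid represented by a word. -/
def wd (l : List B) : Mon M := PresentedMonoid.mk (braidRel M) (FreeMonoid.ofList l)

/-- The generators of the braid monoid. -/
def sig (s : B) : Mon M := wd M [s]

theorem wd_nil : wd M [] = 1 := rfl

theorem wd_append (l l' : List B) : wd M (l ++ l') = wd M l * wd M l' := rfl

theorem wd_cons (s : B) (l : List B) : wd M (s :: l) = sig M s * wd M l := rfl

theorem exists_wd (a : Mon M) : ∃ l, wd M l = a := by
  obtain ⟨l, rfl⟩ := PresentedMonoid.surjective_mk a
  exact ⟨FreeMonoid.toList l, rfl⟩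

/-- The universal property of the braid monoid. -/
def monLift {N : Type*} [Monoid N] (f : B → N)
    (hf : ∀ s t, s ≠ t → M s t ≠ 0 →
      ((altList s t (M s t)).map f).prod = ((altList t s (M s t)).map f).prod) : Mon M →* N :=
  PresentedMonoid.lift f (by
    rintro a b ⟨s, t, hst, h0, rfl, rfl⟩
    simpa [FreeMonoid.lift_apply] using hf s t hst h0)

variable {M} in
theorem monLift_wd {N : Type*} [Monoid N] {f : B → N}
    (hf : ∀ s t, s ≠ t → M s t ≠ 0 →
      ((altList s t (M s t)).map f).prod = ((altList t s (M s t)).map f).prod) (l : List B) :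
    monLift M f hf (wd M l) = (l.map f).prod := by
  induction l with
  | nil => simp [wd_nil]
  | cons s l ih =>
    rw [wd_cons, map_mul, ih, List.map_cons, List.prod_cons]
    rfl

theorem wd_altList_comm (s t : B) (h0 : M s t ≠ 0) :
    wd M (altList s t (M s t)) = wd M (altList t s (M s t)) := by
  by_cases hst : s = t
  · rw [hst]
  · exact PresentedMonoid.mk_eq_mk_of_rel ⟨s, t, hst, h0, rfl, rfl⟩

theorem map_const_prod_altList (s t : B) (n : ℕ) :
    ((altList s t n).map (fun _ => Multiplicative.ofAdd (1 : ℕ))).prod =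
      Multiplicative.ofAdd n := by
  induction n generalizing s t with
  | zero => rfl
  | succ n ih => rw [altList, List.map_cons, List.prod_cons, ih, ← ofAdd_add, add_comm]

/-- The length of an element of the braid monoid. -/
def mlen (a : Mon M) : ℕ := Multiplicative.toAdd
  (monLift M (fun _ => Multiplicative.ofAdd (1 : ℕ)) (by
    intro s t _ _
    rw [map_const_prod_altList, map_const_prod_altList]) a)

variable {M}

theorem mlen_mul (a b : Mon M) : mlen M (a * b) = mlen M a + mlen M b := by
  simp [mlen]

theorem mlen_wd (l : List B) : mlen M (wd M l) = l.length := by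
  rw [mlen, monLift_wd]
  simp

@[simp] theorem mlen_one : mlen M 1 = 0 := by simp [mlen]

@[simp] theorem mlen_sig (s : B) : mlen M (sig M s) = 1 := mlen_wd [s]

theorem exists_sig_mul {a : Mon M} (h : a ≠ 1) : ∃ s b, a = sig M s * b := by
  obtain ⟨l, rfl⟩ := exists_wd M a
  cases l with
  | nil => exact absurd rfl h
  | cons s l => exact ⟨s, wd M l, rfl⟩

theorem eq_one_of_mlen_eq_zero {a : Mon M} (h : mlen M a = 0) : a = 1 := by
  by_contra hn
  obtain ⟨s, b, rfl⟩ := exists_sig_mul hn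
  rw [mlen_mul, mlen_sig] at h
  omega

theorem mlen_le_of_dvd {a b : Mon M} (h : a ∣ b) : mlen M a ≤ mlen M b := by
  obtain ⟨c, rfl⟩ := h
  rw [mlen_mul]; omega

variable (M)

theorem map_simple_prod_altList (s t : B) :
    ((altList s t (M s t)).map (cs).simple).prod = ((altList t s (M s t)).map (cs).simple).prod := by
  have h := (cs).wordProd_braidWord_eq s t
  rw [CoxeterSystem.braidWord, CoxeterSystem.braidWord, M.symmetric t s] at h
  have h' := congrArg (·⁻¹) h
  simp only [← (cs).wordProd_reverse, ← altList_eq_reverse_alternatingWord] at h'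
  exact h'.symm

/-- The projection of the braid monoid on the Coxeter group. -/
noncomputable def pr : Mon M →* M.Group :=
  monLift M (cs).simple (fun s t _ _ => map_simple_prod_altList M s t)

theorem pr_wd (l : List B) : pr M (wd M l) = (cs).wordProd l := monLift_wd _ l

@[simp] theorem pr_sig (s : B) : pr M (sig M s) = (cs).simple s := by
  rw [sig, pr_wd, (cs).wordProd_singleton]

theorem altList_succ (s t : B) (n : ℕ) :
    altList s t (n + 1) = altList s t n ++ [if Even n then s else t] := by
  induction n generalizing s t with
  | zero => simp [altList]
  | succ n ih =>
    rw [altList, ih, altList, List.cons_append]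
    by_cases h : Even n <;> simp [h, Nat.even_add_one]

theorem reverse_altList (s t : B) (n : ℕ) :
    (altList s t n).reverse = if Even n then altList t s n else altList s t n := by
  induction n with
  | zero => simp [altList]
  | succ n ih =>
    conv_lhs => rw [altList_succ, List.reverse_append, ih]
    by_cases h : Even n <;> simp [h, Nat.even_add_one, altList]

theorem wd_reverse_altList (s t : B) (h0 : M s t ≠ 0) :
    wd M (altList s t (M s t)).reverse = wd M (altList s t (M s t)) := by
  rw [reverse_altList]
  split_ifs
  · rw [wd_altList_comm M s t h0]
  · rfl

theorem map_op_prod (l : List B) :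
    (l.map (fun s => MulOpposite.op (sig M s))).prod = MulOpposite.op (wd M l.reverse) := by
  induction l with
  | nil => rfl
  | cons s l ih =>
    rw [List.map_cons, List.prod_cons, ih, List.reverse_cons, wd_append, MulOpposite.op_mul]
    rfl

/-- The anti-automorphism of the braid monoid reversing words. -/
def mrev (a : Mon M) : Mon M := MulOpposite.unop
  (monLift M (fun s => MulOpposite.op (sig M s)) (by
    intro s t _ h0
    rw [map_op_prod, map_op_prod, wd_reverse_altList M s t h0]
    rw [M.symmetric s t] at h0 ⊢
    rw [wd_reverse_altList M t s h0, wd_altList_comm M t s h0]) a)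

variable {M}

theorem mrev_mul (a b : Mon M) : mrev M (a * b) = mrev M b * mrev M a := by
  simp [mrev]

theorem mrev_wd (l : List B) : mrev M (wd M l) = wd M l.reverse := by
  rw [mrev, monLift_wd, map_op_prod, MulOpposite.unop_op]

@[simp] theorem mrev_one : mrev M 1 = 1 := mrev_wd []

@[simp] theorem mrev_sig (s : B) : mrev M (sig M s) = sig M s := mrev_wd [s]

@[simp] theorem mrev_mrev (a : Mon M) : mrev M (mrev M a) = a := by
  obtain ⟨l, rfl⟩ := exists_wd M a
  rw [mrev_wd, mrev_wd, List.reverse_reverse]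

@[simp] theorem mlen_mrev (a : Mon M) : mlen M (mrev M a) = mlen M a := by
  obtain ⟨l, rfl⟩ := exists_wd M a
  rw [mrev_wd, mlen_wd, mlen_wd, List.length_reverse]

theorem pr_mrev (a : Mon M) : pr M (mrev M a) = (pr M a)⁻¹ := by
  obtain ⟨l, rfl⟩ := exists_wd M a
  rw [mrev_wd, pr_wd, pr_wd, (cs).wordProd_reverse]

theorem mrev_dvd_mrev {a b : Mon M} : mrev M a ∣ mrev M b ↔ ∃ c, b = c * a := by
  constructor
  · rintro ⟨c, hc⟩
    refine ⟨mrev M c, ?_⟩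
    rw [← mrev_mrev b, hc, mrev_mul, mrev_mrev]
  · rintro ⟨c, rfl⟩
    exact ⟨mrev M c, mrev_mul _ _⟩

open Classical in
theorem map_indicator_prod_altList (X : Set B) (s t : B) (n : ℕ) :
    ((altList s t (n + 2)).map (fun s => if s ∈ X then 1 else 0)).prod =
      (if s ∈ X then 1 else 0) * if t ∈ X then 1 else 0 := by
  induction n generalizing s t with
  | zero => simp [altList]
  | succ n ih =>
    rw [altList, List.map_cons, List.prod_cons, ih]
    split_ifs <;> simp

variable (M) in
open Classical in
/-- The multiplicative indicator of the submonoid generated by `X`. -/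
noncomputable def indX (X : Set B) : Mon M →* ℕ :=
  monLift M (fun s => if s ∈ X then 1 else 0) (by
    intro s t hst h0
    obtain ⟨n, hn⟩ : ∃ n, M s t = n + 2 := ⟨M s t - 2, by have := M.off_diagonal s t hst; omega⟩
    rw [hn, map_indicator_prod_altList, map_indicator_prod_altList, mul_comm])

/-- `a` lies in the submonoid of the braid monoid generated by `X`. -/
def posOn (X : Set B) (a : Mon M) : Prop := indX M X a = 1

theorem posOn_mul {X : Set B} {a b : Mon M} : posOn X (a * b) ↔ posOn X a ∧ posOn X b := by
  rw [posOn, map_mul, mul_eq_one]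
  rfl

@[simp] theorem posOn_one (X : Set B) : posOn X (1 : Mon M) := map_one _

@[simp] theorem posOn_sig {X : Set B} {s : B} : posOn X (sig M s) ↔ s ∈ X := by
  classical
  rw [posOn, indX, sig, monLift_wd]
  simp

theorem posOn_wd {X : Set B} {l : List B} : posOn X (wd M l) ↔ ∀ s ∈ l, s ∈ X := by
  induction l with
  | nil => simp [wd_nil]
  | cons s l ih => rw [wd_cons, posOn_mul, ih, posOn_sig, List.forall_mem_cons]

theorem posOn_mono {X Y : Set B} (h : X ⊆ Y) {a : Mon M} (ha : posOn X a) : posOn Y a := by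
  obtain ⟨l, rfl⟩ := exists_wd M a
  rw [posOn_wd] at ha ⊢
  exact fun s hs => h (ha s hs)

theorem posOn_univ (a : Mon M) : posOn Set.univ a := by
  obtain ⟨l, rfl⟩ := exists_wd M a
  exact posOn_wd.2 fun s _ => Set.mem_univ s

theorem posOn_mrev {X : Set B} {a : Mon M} : posOn X (mrev M a) ↔ posOn X a := by
  obtain ⟨l, rfl⟩ := exists_wd M a
  simp [mrev_wd, posOn_wd]

theorem sig_injective : Function.Injective (sig M) := by
  intro s t h
  have : posOn {t} (sig M s) := by rw [h]; simp
  simpa using this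

theorem exists_eq_sig {a : Mon M} (h : mlen M a = 1) : ∃ s, a = sig M s := by
  obtain ⟨s, b, rfl⟩ := exists_sig_mul (a := a) (by rintro rfl; simp at h)
  rw [mlen_mul, mlen_sig] at h
  rw [eq_one_of_mlen_eq_zero (a := b) (by omega), mul_one]
  exact ⟨s, rfl⟩

end Monoid

section Simple

variable {M : CoxeterMatrix B}

local notation "cs" => CoxeterMatrix.toCoxeterSystem M

/-- An element of the braid monoid is simple when its words are reduced in the Coxeter group. -/
def Simple (a : Mon M) : Prop := (cs).length (pr M a) = mlen M a

theorem length_pr_le (a : Mon M) : (cs).length (pr M a) ≤ mlen M a := by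
  obtain ⟨l, rfl⟩ := exists_wd M a
  rw [pr_wd, mlen_wd]
  exact (cs).length_wordProd_le l

theorem simple_one : Simple (1 : Mon M) := by simp [Simple]

theorem simple_sig (s : B) : Simple (sig M s) := by
  rw [Simple, pr_sig, (cs).length_simple, mlen_sig]

theorem Simple.of_mul {a b : Mon M} (h : Simple (a * b)) : Simple a ∧ Simple b := by
  have h1 := length_pr_le a
  have h2 := length_pr_le b
  have h3 := (cs).length_mul_le (pr M a) (pr M b)
  rw [Simple, map_mul, mlen_mul] at h
  constructor <;> unfold Simple <;> omega

theorem simple_mrev {a : Mon M} : Simple (mrev M a) ↔ Simple a := by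
  rw [Simple, Simple, pr_mrev, (cs).length_inv, mlen_mrev]

theorem Simple.isLeftDescent {s : B} {a : Mon M} (h : Simple (sig M s * a)) :
    (cs).IsLeftDescent (pr M (sig M s * a)) s := by
  have := length_pr_le a
  rw [CoxeterSystem.IsLeftDescent, h, map_mul, pr_sig, (cs).simple_mul_simple_cancel_left,
    mlen_mul, mlen_sig]
  omega

theorem Simple.not_isLeftDescent {s : B} {a : Mon M} (h : Simple (sig M s * a)) :
    ¬ (cs).IsLeftDescent (pr M a) s := by
  have h' : (cs).length (pr M a) = mlen M a := h.of_mul.2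
  have := h
  rw [Simple, map_mul, pr_sig, mlen_mul, mlen_sig] at this
  rw [CoxeterSystem.IsLeftDescent, h', this]
  omega

variable (M) in
/-- The lcm of two generators. -/
def dihed (s t : B) : Mon M := wd M (altList s t (M s t))

variable (M) in
/-- The element `c` such that `s c` is the lcm of the generators `s` and `t`. -/
def resid (s t : B) : Mon M := wd M (altList t s (M s t - 1))

theorem Simple.eq_dihed_mul {s t : B} (hst : s ≠ t) {a b : Mon M}
    (h : sig M s * a = sig M t * b) (ha : Simple (sig M s * a)) :
    ∃ c, pr M (sig M s * a) = pr M (dihed M s t * c) ∧ Simple (dihed M s t * c) := by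
  obtain ⟨ω, e, hl⟩ := (exists_altList_append_of_isLeftDescent M hst ha.isLeftDescent
    (h ▸ (h ▸ ha).isLeftDescent) le_rfl).1
  refine ⟨wd M ω, ?_, ?_⟩
  · rw [e, dihed, ← wd_append, pr_wd]
  · rw [Simple, dihed, ← wd_append, pr_wd, ← e, hl, mlen_wd, List.length_append, length_altList]

variable [Finite M.Group]

theorem dihed_comm (s t : B) : dihed M s t = dihed M t s := by
  rw [dihed, wd_altList_comm M s t (matrix_ne_zero M s t), dihed, M.symmetric]

theorem sig_mul_resid (s t : B) : sig M s * resid M s t = dihed M s t := by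
  rw [dihed, resid, ← wd_cons]
  have := matrix_ne_zero M s t
  obtain ⟨n, hn⟩ : ∃ n, M s t = n + 1 := ⟨M s t - 1, by omega⟩
  rw [hn]
  rfl

theorem mrev_dihed (s t : B) : mrev M (dihed M s t) = dihed M s t := by
  rw [dihed, mrev_wd, wd_reverse_altList M s t (matrix_ne_zero M s t)]

/-- Matsumoto's theorem. -/
theorem Simple.eq_of_pr_eq {a b : Mon M} (ha : Simple a) (hb : Simple b)
    (h : pr M a = pr M b) : a = b := by
  induction hn : mlen M a generalizing a b with
  | zero =>
    have hb' : mlen M b = 0 := by rw [← hb, ← h, ha, hn]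
    rw [eq_one_of_mlen_eq_zero hn, eq_one_of_mlen_eq_zero hb']
  | succ n ih =>
    have hb' : mlen M b = n + 1 := by rw [← hb, ← h, ha, hn]
    have key : ∀ (r : B) (x y : Mon M), Simple (sig M r * x) → Simple (sig M r * y) →
        pr M (sig M r * x) = pr M (sig M r * y) → mlen M (sig M r * x) = n + 1 →
        sig M r * x = sig M r * y := by
      intro r x y hx hy hxy hlx
      rw [map_mul, map_mul] at hxy
      rw [mlen_mul, mlen_sig] at hlx
      rw [ih hx.of_mul.2 hy.of_mul.2 (mul_left_cancel hxy) (by omega)]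
    obtain ⟨s, a, rfl⟩ := exists_sig_mul (a := a) (by rintro rfl; simp at hn)
    obtain ⟨t, b, rfl⟩ := exists_sig_mul (a := b) (by rintro rfl; simp at hb')
    by_cases hst : s = t
    · subst hst
      exact key s a b ha hb h hn
    · obtain ⟨ω, e, hl⟩ := (exists_altList_append_of_isLeftDescent M hst ha.isLeftDescent
        (h ▸ hb.isLeftDescent) le_rfl).1
      have hd : Simple (dihed M s t * wd M ω) := by
        rw [Simple, dihed, ← wd_append, pr_wd, ← e, hl, mlen_wd, List.length_append, length_altList]
      have hp : pr M (sig M s * a) = pr M (dihed M s t * wd M ω) := by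
        rw [e, dihed, ← wd_append, pr_wd]
      have e1 : sig M s * a = dihed M s t * wd M ω := by
        rw [← sig_mul_resid, mul_assoc] at hd hp ⊢
        exact key s _ _ ha hd hp hn
      have e2 : sig M t * b = dihed M s t * wd M ω := by
        rw [h] at hp
        rw [dihed_comm, ← sig_mul_resid, mul_assoc] at hd hp ⊢
        exact key t _ _ hb hd hp hb'
      rw [e1, e2]

theorem Simple.dihed_dvd {s t : B} (hst : s ≠ t) {x : Mon M} (hx : Simple x)
    (hs : sig M s ∣ x) (ht : sig M t ∣ x) : dihed M s t ∣ x := by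
  obtain ⟨a, rfl⟩ := hs
  obtain ⟨b, hb⟩ := ht
  obtain ⟨c, h1, h2⟩ := hx.eq_dihed_mul hst hb
  exact ⟨c, hx.eq_of_pr_eq h2 h1⟩

theorem Simple.mul_dihed {w : Mon M} {a b : B} (hab : a ≠ b) (ha : Simple (w * sig M a))
    (hb : Simple (w * sig M b)) : Simple (w * dihed M a b) := by
  have hw : Simple (mrev M w) := simple_mrev.2 ha.of_mul.1
  rw [← simple_mrev, mrev_mul, mrev_sig] at ha hb
  rw [← simple_mrev, mrev_mul, mrev_dihed, Simple, map_mul, dihed, pr_wd,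
    length_altList_mul M hab ha.not_isLeftDescent hb.not_isLeftDescent le_rfl, hw, mlen_mul,
    mlen_wd, length_altList]

/-- A bounded set of elements closed under prefixes and local joins has a greatest element. -/
theorem exists_greatest (F : Set (Mon M)) (h1 : (1 : Mon M) ∈ F)
    (hpre : ∀ x y, x * y ∈ F → x ∈ F) (hbdd : ∃ N, ∀ x ∈ F, mlen M x ≤ N)
    (hjoin : ∀ w a b, a ≠ b → w * sig M a ∈ F → w * sig M b ∈ F → w * dihed M a b ∈ F) :
    ∃ x ∈ F, ∀ y ∈ F, y ∣ x := by
  obtain ⟨N, hN⟩ := hbdd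
  obtain ⟨x, hx, hmax⟩ : ∃ x ∈ F, ∀ y ∈ F, mlen M y ≤ mlen M x := by
    have hB : BddAbove (mlen M '' F) := ⟨N, by rintro _ ⟨x, hx, rfl⟩; exact hN x hx⟩
    obtain ⟨x, hx, e⟩ := Nat.sSup_mem ⟨_, Set.mem_image_of_mem _ h1⟩ hB
    exact ⟨x, hx, fun y hy => e ▸ le_csSup hB (Set.mem_image_of_mem _ hy)⟩
  refine ⟨x, hx, ?_⟩
  have claim : ∀ n y, mlen M x - mlen M y = n → y ∣ x → ∀ a, y * sig M a ∈ F →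
      y * sig M a ∣ x := by
    intro n
    induction n using Nat.strong_induction_on with
    | _ n ih =>
    rintro y hn ⟨z, rfl⟩ a ha
    by_cases hz : z = 1
    · have := hmax _ ha
      rw [hz, mul_one, mlen_mul, mlen_sig] at this
      omega
    obtain ⟨b, z, rfl⟩ := exists_sig_mul hz
    by_cases hab : b = a
    · exact ⟨z, by rw [hab, mul_assoc]⟩
    rw [← mul_assoc] at hx
    have hD := hjoin y b a hab (hpre _ _ hx) ha
    have walk : ∀ k, 1 ≤ k → k ≤ M b a →
        y * wd M (altList b a k) ∣ y * (sig M b * z) := by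
      intro k hk1 hk
      induction k, hk1 using Nat.le_induction with
      | base => exact ⟨z, by rw [mul_assoc]; rfl⟩
      | succ k hk1 ihk =>
        obtain ⟨c, d, -, e⟩ := altList_add b a (k + 1) (M b a - (k + 1))
        rw [Nat.add_sub_cancel' hk] at e
        rw [dihed, e, wd_append, ← mul_assoc] at hD
        have hD' := hpre _ _ hD
        rw [altList_succ, wd_append, ← mul_assoc] at hD' ⊢
        refine ih _ ?_ _ rfl (ihk (by omega)) _ hD'
        rw [← hn, mlen_mul, mlen_mul, mlen_mul, mlen_sig, mlen_wd, length_altList]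
        omega
    have hbig := walk (M b a) (Nat.one_le_iff_ne_zero.2 (matrix_ne_zero M b a)) le_rfl
    rw [← dihed, dihed_comm, ← sig_mul_resid, ← mul_assoc] at hbig
    exact (Dvd.intro _ rfl).trans hbig
  intro y hy
  obtain ⟨l, rfl⟩ := exists_wd M y
  induction l using List.reverseRecOn with
  | nil => exact one_dvd x
  | append_singleton l a ih =>
    rw [wd_append] at hy ⊢
    exact claim _ _ rfl (ih (hpre _ _ hy)) a hy

end Simple

section Cancellation

variable {M : CoxeterMatrix B}

theorem simple_dihed [Finite M.Group] {s t : B} (hst : s ≠ t) : Simple (dihed M s t) := by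
  have := Simple.mul_dihed (M := M) (w := 1) hst
    (by rw [one_mul]; exact simple_sig s) (by rw [one_mul]; exact simple_sig t)
  rwa [one_mul] at this

/-- `s a = t b` is a consequence of the braid relation between `s` and `t`. -/
def Confl (s t : B) (a b : Mon M) : Prop :=
  (s = t → a = b) ∧ (s ≠ t → ∃ c, a = resid M s t * c ∧ b = resid M t s * c)

theorem Confl.symm {s t : B} {a b : Mon M} (h : Confl s t a b) : Confl t s b a := by
  refine ⟨fun e => (h.1 e.symm).symm, fun e => ?_⟩
  obtain ⟨c, h1, h2⟩ := h.2 e.symm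
  exact ⟨c, h2, h1⟩

theorem mul_left_cancel_of_confl {n : ℕ}
    (hn : ∀ (s t : B) (a b : Mon M), mlen M a < n → sig M s * a = sig M t * b → Confl s t a b)
    {p a b : Mon M} (h : p * a = p * b) (hl : mlen M (p * a) ≤ n) : a = b := by
  obtain ⟨l, rfl⟩ := exists_wd M p
  induction l with
  | nil => simpa [wd_nil] using h
  | cons s l ih =>
    rw [wd_cons, mul_assoc, mul_assoc] at h
    rw [wd_cons, mul_assoc, mlen_mul, mlen_sig] at hl
    exact ih ((hn s s _ _ (by omega) h).1 rfl) (by omega)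

variable [Finite M.Group]

theorem Confl.trans {n : ℕ}
    (hn : ∀ (s t : B) (a b : Mon M), mlen M a < n → sig M s * a = sig M t * b → Confl s t a b)
    {s r t : B} {a d b : Mon M} (hd : mlen M d ≤ n)
    (h1 : Confl s r a d) (h2 : Confl r t d b) : Confl s t a b := by
  by_cases hsr : s = r
  · rw [h1.1 hsr, hsr]; exact h2
  by_cases hrt : r = t
  · rw [← h2.1 hrt, ← hrt]; exact h1
  obtain ⟨c₁, rfl, hd1⟩ := h1.2 hsr
  obtain ⟨c₂, hd2, rfl⟩ := h2.2 hrt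
  constructor
  · rintro rfl
    rw [mul_left_cancel_of_confl hn (hd1.symm.trans hd2) (hd1 ▸ hd)]
  intro hst
  obtain ⟨x, ⟨-, hx2, e, he⟩, hmax⟩ := exists_greatest
    {w : Mon M | Simple w ∧ Simple (sig M r * w) ∧ w ∣ d}
    ⟨simple_one, by rw [mul_one]; exact simple_sig r, one_dvd d⟩
    (fun x y h => ⟨h.1.of_mul.1, (by
      have := h.2.1
      rw [← mul_assoc] at this
      exact this.of_mul.1), (Dvd.intro _ rfl).trans h.2.2⟩)
    ⟨mlen M d, fun x hx => mlen_le_of_dvd hx.2.2⟩ (by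
      rintro w p q hpq ⟨a1, a2, f, a3⟩ ⟨b1, b2, g, b3⟩
      refine ⟨a1.mul_dihed hpq b1, ?_, ?_⟩
      · rw [← mul_assoc] at a2 b2 ⊢
        exact a2.mul_dihed hpq b2
      · rw [mul_assoc] at a3 b3
        have h := mul_left_cancel_of_confl hn (a3.symm.trans b3) (a3 ▸ hd)
        have hf : mlen M f < n := by
          rw [a3, mlen_mul, mlen_mul, mlen_sig] at hd
          omega
        obtain ⟨c, hc, -⟩ := (hn p q f g hf h).2 hpq
        exact ⟨c, by rw [a3, hc, ← sig_mul_resid]; simp only [mul_assoc]⟩)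
  have hmem : ∀ u : B, u ≠ r → resid M r u ∣ d → resid M r u ∣ x := by
    intro u hu hud
    have hs : Simple (sig M r * resid M r u) := by
      rw [sig_mul_resid]; exact simple_dihed hu.symm
    exact hmax _ ⟨hs.of_mul.2, hs, hud⟩
  obtain ⟨x₁, hx₁⟩ := hmem s hsr ⟨c₁, hd1⟩
  obtain ⟨x₂, hx₂⟩ := hmem t (Ne.symm hrt) ⟨c₂, hd2⟩
  have hc₁ : c₁ = x₁ * e := by
    refine mul_left_cancel_of_confl hn (p := resid M r s) ?_ (hd1 ▸ hd)
    rw [← hd1, he, hx₁, mul_assoc]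
  have hc₂ : c₂ = x₂ * e := by
    refine mul_left_cancel_of_confl hn (p := resid M r t) ?_ (hd2 ▸ hd)
    rw [← hd2, he, hx₂, mul_assoc]
  have ys : sig M r * x = sig M s * (resid M s r * x₁) := by
    rw [hx₁, ← mul_assoc, sig_mul_resid, dihed_comm, ← sig_mul_resid, mul_assoc]
  have yt : sig M r * x = sig M t * (resid M t r * x₂) := by
    rw [hx₂, ← mul_assoc, sig_mul_resid, dihed_comm, ← sig_mul_resid, mul_assoc]
  obtain ⟨z, hz⟩ := hx2.dihed_dvd hst ⟨_, ys⟩ ⟨_, yt⟩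
  have cancel : ∀ (u : B) (p q : Mon M), sig M r * x = sig M u * p →
      sig M r * x = sig M u * q → p = q := by
    intro u p q hp hq
    refine (hp ▸ hx2).of_mul.2.eq_of_pr_eq (hq ▸ hx2).of_mul.2 ?_
    have := congrArg (pr M) (hp.symm.trans hq)
    rw [map_mul, map_mul] at this
    exact mul_left_cancel this
  refine ⟨z * e, ?_, ?_⟩
  · rw [hc₁, ← mul_assoc, ← mul_assoc, cancel s _ (resid M s t * z) ys (by
      rw [hz, ← sig_mul_resid, mul_assoc])]
  · rw [hc₂, ← mul_assoc, ← mul_assoc, cancel t _ (resid M t s * z) yt (by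
      rw [hz, dihed_comm, ← sig_mul_resid, mul_assoc])]

theorem confl_of_rel {n : ℕ}
    (hn : ∀ (s t : B) (a b : Mon M), mlen M a < n → sig M s * a = sig M t * b → Confl s t a b)
    {u v : FreeMonoid B} (h : ConGen.Rel (braidRel M) u v) :
    wd M (FreeMonoid.toList u) = wd M (FreeMonoid.toList v) ∧
    ∀ (s t : B) (a b : List B), FreeMonoid.toList u = s :: a → FreeMonoid.toList v = t :: b →
      a.length ≤ n → Confl s t (wd M a) (wd M b) := by
  induction h with
  | of u v h =>
    obtain ⟨p, q, hpq, h0, rfl, rfl⟩ := h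
    refine ⟨wd_altList_comm M p q h0, ?_⟩
    intro s t a b hu hv _
    obtain ⟨n, hn⟩ : ∃ n, M p q = n + 1 := ⟨M p q - 1, by omega⟩
    have hn' : M q p = n + 1 := by rw [M.symmetric, hn]
    rw [hn] at hu hv
    simp only [altList, FreeMonoid.toList_ofList, List.cons.injEq] at hu hv
    obtain ⟨rfl, rfl⟩ := hu
    obtain ⟨rfl, rfl⟩ := hv
    refine ⟨fun h => absurd h hpq, fun _ => ⟨1, ?_, ?_⟩⟩
    · rw [mul_one, resid, hn, Nat.add_sub_cancel]
    · rw [mul_one, resid, hn', Nat.add_sub_cancel]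
  | refl u =>
    refine ⟨rfl, fun s t a b hu hv _ => ?_⟩
    rw [hu] at hv
    obtain ⟨rfl, rfl⟩ := List.cons.inj hv
    exact ⟨fun _ => rfl, fun h => absurd rfl h⟩
  | symm h ih =>
    refine ⟨ih.1.symm, fun s t a b hu hv hl => (ih.2 t s b a hv hu ?_).symm⟩
    have := congrArg (mlen M) ih.1
    rw [hu, hv, mlen_wd, mlen_wd, List.length_cons, List.length_cons] at this
    omega
  | @trans u w v h1 h2 ih1 ih2 =>
    refine ⟨ih1.1.trans ih2.1, fun s t a b hu hv hl => ?_⟩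
    have := congrArg (mlen M) ih1.1
    rw [hu, mlen_wd, mlen_wd, List.length_cons] at this
    obtain ⟨r, d, hw⟩ := List.exists_cons_of_length_eq_add_one this.symm
    rw [hw, List.length_cons] at this
    refine Confl.trans hn (d := wd M d) (by rw [mlen_wd]; omega)
      (ih1.2 s r a d hu hw hl) (ih2.2 r t d b hw hv (by omega))
  | @mul u u' v v' h1 h2 ih1 ih2 =>
    refine ⟨?_, fun s t a b hu hv hl => ?_⟩
    · rw [FreeMonoid.toList_mul, FreeMonoid.toList_mul, wd_append, wd_append, ih1.1, ih2.1]
    have hlen := congrArg (mlen M) ih1.1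
    rw [mlen_wd, mlen_wd] at hlen
    rw [FreeMonoid.toList_mul] at hu hv
    cases hp : FreeMonoid.toList u with
    | nil =>
      rw [hp, List.length_nil] at hlen
      rw [hp, List.nil_append] at hu
      rw [List.eq_nil_of_length_eq_zero hlen.symm, List.nil_append] at hv
      exact ih2.2 s t a b hu hv hl
    | cons p a₁ =>
      rw [hp, List.length_cons] at hlen
      obtain ⟨q, b₁, hq⟩ := List.exists_cons_of_length_eq_add_one hlen.symm
      rw [hp, List.cons_append] at hu
      rw [hq, List.cons_append] at hv
      obtain ⟨rfl, rfl⟩ := List.cons.inj hu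
      obtain ⟨rfl, rfl⟩ := List.cons.inj hv
      rw [List.length_append] at hl
      have := ih1.2 p q a₁ b₁ hp hq (by omega)
      rw [wd_append, wd_append, ih2.1]
      refine ⟨fun e => by rw [this.1 e], fun e => ?_⟩
      obtain ⟨c, hc, hc'⟩ := this.2 e
      exact ⟨c * wd M (FreeMonoid.toList v'), by rw [hc, mul_assoc], by rw [hc', mul_assoc]⟩

theorem confl_of_eq {s t : B} {a b : Mon M} (h : sig M s * a = sig M t * b) : Confl s t a b := by
  induction hn : mlen M a using Nat.strong_induction_on generalizing s t a b with
  | _ n ih =>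
  obtain ⟨l, rfl⟩ := exists_wd M a
  obtain ⟨l', rfl⟩ := exists_wd M b
  rw [mlen_wd] at hn
  have hrel : ConGen.Rel (braidRel M) (FreeMonoid.ofList (s :: l)) (FreeMonoid.ofList (t :: l')) :=
    PresentedMonoid.mk_eq_mk_iff.1 h
  exact (confl_of_rel (n := n) (fun s t a b hl h => ih _ hl h rfl) hrel).2 s t l l' rfl rfl hn.le

instance : IsLeftCancelMul (Mon M) := ⟨fun a b _ h =>
  mul_left_cancel_of_confl (n := mlen M (a * b)) (fun _ _ _ _ _ h => confl_of_eq h) h le_rfl⟩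

instance : IsRightCancelMul (Mon M) := ⟨fun a b c h => by
  have := congrArg (mrev M) h
  rw [mrev_mul, mrev_mul] at this
  rw [← mrev_mrev b, mul_left_cancel this, mrev_mrev]⟩

theorem dihed_dvd {s t : B} (hst : s ≠ t) {x : Mon M} (hs : sig M s ∣ x) (ht : sig M t ∣ x) :
    dihed M s t ∣ x := by
  obtain ⟨a, rfl⟩ := hs
  obtain ⟨b, hb⟩ := ht
  obtain ⟨c, rfl, -⟩ := (confl_of_eq hb).2 hst
  exact ⟨c, by rw [← mul_assoc, sig_mul_resid]⟩

theorem mul_dihed_dvd {s t : B} (hst : s ≠ t) {w x : Mon M} (hs : w * sig M s ∣ x)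
    (ht : w * sig M t ∣ x) : w * dihed M s t ∣ x := by
  obtain ⟨a, rfl⟩ := hs
  obtain ⟨b, hb⟩ := ht
  rw [mul_assoc, mul_assoc] at hb
  rw [mul_assoc]
  exact mul_dvd_mul_left w (dihed_dvd hst ⟨a, rfl⟩ ⟨b, mul_left_cancel hb⟩)

end Cancellation

section Garside

variable {M : CoxeterMatrix B}

local notation "cs" => CoxeterMatrix.toCoxeterSystem M

theorem exists_mul_sig {a : Mon M} (h : a ≠ 1) : ∃ b s, a = b * sig M s := by
  obtain ⟨s, b, e⟩ := exists_sig_mul (a := mrev M a) (by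
    intro h'
    rw [← mrev_mrev a, h', mrev_one] at h
    exact h rfl)
  exact ⟨mrev M b, s, by rw [← mrev_mrev a, e, mrev_mul, mrev_sig]⟩

theorem eq_of_dvd_of_mlen_le {a b : Mon M} (h : a ∣ b) (hl : mlen M b ≤ mlen M a) : a = b := by
  obtain ⟨c, rfl⟩ := h
  rw [mlen_mul] at hl
  rw [eq_one_of_mlen_eq_zero (a := c) (by omega), mul_one]

theorem dvd_antisymm_mon {a b : Mon M} (h : a ∣ b) (h' : b ∣ a) : a = b :=
  eq_of_dvd_of_mlen_le h (mlen_le_of_dvd h')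

theorem mem_of_mem_altList {s t x : B} {n : ℕ} (h : x ∈ altList s t n) : x = s ∨ x = t := by
  induction n generalizing s t with
  | zero => simp [altList] at h
  | succ n ih =>
    rw [altList, List.mem_cons] at h
    exact h.elim .inl fun h => (ih h).symm

theorem posOn_dihed {X : Set B} {s t : B} (hs : s ∈ X) (ht : t ∈ X) : posOn X (dihed M s t) :=
  posOn_wd.2 fun x hx => by
    rcases mem_of_mem_altList hx with rfl | rfl <;> assumption

/-- No letter of `X` divides `a` on the left. -/
def lred (X : Set B) (a : Mon M) : Prop := ∀ s ∈ X, ¬ sig M s ∣ a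

theorem eq_one_of_posOn_of_dvd {X : Set B} {e p : Mon M} (he : posOn X e) (hp : lred X p)
    (h : e ∣ p) : e = 1 := by
  by_contra hn
  obtain ⟨s, b, rfl⟩ := exists_sig_mul hn
  rw [posOn_mul, posOn_sig] at he
  exact hp s he.1 ((Dvd.intro _ rfl).trans h)

theorem exists_eq_mul_lred (X : Set B) (a : Mon M) :
    ∃ z h, posOn X z ∧ lred X h ∧ a = z * h := by
  induction hn : mlen M a using Nat.strong_induction_on generalizing a with
  | _ n ih =>
  by_cases ha : lred X a
  · exact ⟨1, a, posOn_one X, ha, (one_mul a).symm⟩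
  · unfold lred at ha
    push Not at ha
    obtain ⟨s, hs, b, rfl⟩ := ha
    rw [mlen_mul, mlen_sig] at hn
    obtain ⟨z, h, hz, hh, rfl⟩ := ih _ (by omega) b rfl
    exact ⟨sig M s * z, h, posOn_mul.2 ⟨posOn_sig.2 hs, hz⟩, hh, by rw [mul_assoc]⟩

variable [Finite M.Group]

theorem exists_gcd (a b : Mon M) : ∃ g, g ∣ a ∧ g ∣ b ∧ ∀ y, y ∣ a → y ∣ b → y ∣ g := by
  obtain ⟨g, hg, hmax⟩ := exists_greatest {y : Mon M | y ∣ a ∧ y ∣ b} ⟨one_dvd a, one_dvd b⟩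
    (fun x y h => ⟨(Dvd.intro _ rfl).trans h.1, (Dvd.intro _ rfl).trans h.2⟩)
    ⟨mlen M a, fun x hx => mlen_le_of_dvd hx.1⟩
    (fun w p q hpq hp hq => ⟨mul_dihed_dvd hpq hp.1 hq.1, mul_dihed_dvd hpq hp.2 hq.2⟩)
  exact ⟨g, hg.1, hg.2, fun y h1 h2 => hmax y ⟨h1, h2⟩⟩

/-- The decomposition of a positive element as an element of `A_X⁺` times an `X`-reduced
element is unique. -/
theorem eq_of_mul_lred_eq {X : Set B} {b c p q : Mon M} (hb : posOn X b) (hc : posOn X c)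
    (hp : lred X p) (hq : lred X q) (h : b * p = c * q) : b = c ∧ p = q := by
  obtain ⟨x, hx, hmax⟩ := exists_greatest {y : Mon M | posOn X y ∧ y ∣ b * p}
    ⟨posOn_one X, one_dvd _⟩
    (fun x y h => ⟨(posOn_mul.1 h.1).1, (Dvd.intro _ rfl).trans h.2⟩)
    ⟨mlen M (b * p), fun x hx => mlen_le_of_dvd hx.2⟩ (by
      intro w s t hst hs ht
      simp only [Set.mem_ofPred_eq, posOn_mul, posOn_sig] at hs ht ⊢
      exact ⟨⟨hs.1.1, posOn_dihed hs.1.2 ht.1.2⟩, mul_dihed_dvd hst hs.2 ht.2⟩)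
  have key : ∀ b p, posOn X b → lred X p → b ∣ x → x ∣ b * p → b = x := by
    rintro b p - hp ⟨e, he⟩ ⟨f, hf⟩
    rw [he, mul_assoc] at hf
    have := eq_one_of_posOn_of_dvd (posOn_mul.1 (he ▸ hx.1)).2 hp ⟨f, mul_left_cancel hf⟩
    rw [he, this, mul_one]
  have e1 := key b p hb hp (hmax b ⟨hb, Dvd.intro _ rfl⟩) hx.2
  have e2 := key c q hc hq (hmax c ⟨hc, h ▸ Dvd.intro _ rfl⟩) (h ▸ hx.2)
  have e : b = c := e1.trans e2.symm
  exact ⟨e, mul_left_cancel (e ▸ h)⟩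

theorem sig_dvd_of_sig_dvd_mul {s t : B} {g m : Mon M} (hg : ¬ sig M s ∣ g)
    (h : sig M s * g = g * sig M t) (hm : sig M s ∣ g * m) : sig M t ∣ m := by
  obtain ⟨d, hd1, hd2, hmax⟩ := exists_gcd (g * sig M t) (g * m)
  obtain ⟨e, rfl⟩ := hmax g (Dvd.intro _ rfl) (Dvd.intro _ rfl)
  have hs := hmax (sig M s) (h ▸ Dvd.intro _ rfl) hm
  obtain ⟨f, hf⟩ := hd1
  rw [mul_assoc] at hf
  have hf := mul_left_cancel hf
  by_cases he : e = 1
  · rw [he, mul_one] at hs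
    exact absurd hs hg
  · obtain ⟨r, e, rfl⟩ := exists_sig_mul he
    have : sig M t = sig M r * e := by
      refine (eq_of_dvd_of_mlen_le ⟨f, hf⟩ ?_).symm
      rw [mlen_mul, mlen_sig, mlen_sig]
      omega
    obtain ⟨k, hk⟩ := hd2
    rw [mul_assoc] at hk
    exact ⟨k, by rw [this]; exact mul_left_cancel hk⟩

theorem exists_garside (J : Set B) : ∃ d : Mon M, (posOn J d ∧ Simple d) ∧
    ∀ y : Mon M, posOn J y ∧ Simple y → y ∣ d := by
  obtain ⟨N, hN⟩ := (Set.finite_range (cs).length).bddAbove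
  refine exists_greatest {y : Mon M | posOn J y ∧ Simple y} ⟨posOn_one J, simple_one⟩
    (fun x y h => ⟨(posOn_mul.1 h.1).1, h.2.of_mul.1⟩)
    ⟨N, fun x hx => hx.2 ▸ hN (Set.mem_range_self _)⟩ ?_
  intro w s t hst hs ht
  simp only [Set.mem_ofPred_eq, posOn_mul, posOn_sig] at hs ht ⊢
  exact ⟨⟨hs.1.1, posOn_dihed hs.1.2 ht.1.2⟩, hs.2.mul_dihed hst ht.2⟩

variable (M) in
/-- The Garside element of the submonoid generated by `J`. -/
noncomputable def garside (J : Set B) : Mon M := (exists_garside (M := M) J).choose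

theorem posOn_garside (J : Set B) : posOn J (garside M J) :=
  (exists_garside (M := M) J).choose_spec.1.1

theorem simple_garside (J : Set B) : Simple (garside M J) :=
  (exists_garside (M := M) J).choose_spec.1.2

theorem dvd_garside {J : Set B} {y : Mon M} (h : posOn J y) (h' : Simple y) : y ∣ garside M J :=
  (exists_garside (M := M) J).choose_spec.2 y ⟨h, h'⟩

theorem sig_dvd_garside {J : Set B} {s : B} (h : s ∈ J) : sig M s ∣ garside M J :=
  dvd_garside (posOn_sig.2 h) (simple_sig s)

theorem mrev_garside (J : Set B) : mrev M (garside M J) = garside M J :=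
  eq_of_dvd_of_mlen_le (dvd_garside (posOn_mrev.2 (posOn_garside J))
    (simple_mrev.2 (simple_garside J))) (by rw [mlen_mrev])

theorem exists_eq_mul_sig_of_mem {J : Set B} {s : B} (hs : s ∈ J) :
    ∃ c, garside M J = c * sig M s := by
  rw [← mrev_dvd_mrev, mrev_sig, mrev_garside]
  exact sig_dvd_garside hs

theorem exists_sig_mul_garside {J : Set B} {s : B} (h : s ∈ J) :
    ∃ t ∈ J, sig M s * garside M J = garside M J * sig M t := by
  obtain ⟨v, hv⟩ := sig_dvd_garside (M := M) h
  have hp := posOn_garside (M := M) J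
  have hs := simple_garside (M := M) J
  rw [hv] at hp hs
  obtain ⟨c, hc⟩ := dvd_garside (posOn_mul.1 hp).2 hs.of_mul.2
  have hl : mlen M c = 1 := by
    have h1 := congrArg (mlen M) hv
    rw [hc, mlen_mul, mlen_mul, mlen_sig] at h1
    omega
  obtain ⟨t, rfl⟩ := exists_eq_sig hl
  have hp' := posOn_garside (M := M) J
  rw [hc, posOn_mul, posOn_sig] at hp'
  refine ⟨t, hp'.2, ?_⟩
  nth_rw 1 [hc]
  rw [← mul_assoc, ← hv]

theorem exists_garside_mul_sig {J : Set B} {s : B} (h : s ∈ J) :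
    ∃ t ∈ J, garside M J * sig M s = sig M t * garside M J := by
  obtain ⟨t, ht, e⟩ := exists_sig_mul_garside (M := M) h
  refine ⟨t, ht, ?_⟩
  have := congrArg (mrev M) e
  rwa [mrev_mul, mrev_mul, mrev_sig, mrev_sig, mrev_garside] at this

theorem garside_mul_garside_comm {J : Set B} {a : Mon M} (h : posOn J a) :
    garside M J * garside M J * a = a * (garside M J * garside M J) := by
  obtain ⟨l, rfl⟩ := exists_wd M a
  induction l with
  | nil => rw [wd_nil, one_mul, mul_one]
  | cons s l ih =>
    rw [wd_cons, posOn_mul, posOn_sig] at h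
    have e : garside M J * garside M J * sig M s = sig M s * (garside M J * garside M J) := by
      obtain ⟨t, -, e⟩ := exists_sig_mul_garside (M := M) h.1
      have e' := congrArg (mrev M) e
      rw [mrev_mul, mrev_mul, mrev_sig, mrev_sig, mrev_garside] at e'
      rw [mul_assoc, e', ← mul_assoc, ← e, mul_assoc]
    rw [wd_cons, ← mul_assoc, e, mul_assoc, ih h.2, mul_assoc]

theorem eq_garside {J : Set B} {x : Mon M} (hp : posOn J x) (hs : Simple x)
    (h : ∀ s ∈ J, sig M s ∣ x) : x = garside M J := by
  obtain ⟨v, hv⟩ := dvd_garside hp hs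
  by_cases h1 : v = 1
  · rw [hv, h1, mul_one]
  exfalso
  obtain ⟨v, c, rfl⟩ := exists_mul_sig h1
  have hp' := posOn_garside (M := M) J
  rw [hv, posOn_mul, posOn_mul, posOn_sig] at hp'
  obtain ⟨a, ha, e⟩ := exists_garside_mul_sig (M := M) hp'.2.2
  obtain ⟨y, hy⟩ := h a ha
  have : garside M J = y * v * (sig M c * sig M c) := by
    apply mul_left_cancel (a := sig M a)
    rw [← e, hv, hy]
    simp only [mul_assoc]
  have hsimple := simple_garside (M := M) J
  rw [this] at hsimple
  have := hsimple.of_mul.2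
  rw [Simple, map_mul, pr_sig, (cs).simple_mul_simple_self, mlen_mul, mlen_sig,
    (cs).length_one] at this
  omega

theorem garside_dvd {J : Set B} {m : Mon M} (h : ∀ s ∈ J, sig M s ∣ m) : garside M J ∣ m := by
  obtain ⟨x, hx, hmax⟩ := exists_greatest {y : Mon M | (posOn J y ∧ Simple y) ∧ y ∣ m}
    ⟨⟨posOn_one J, simple_one⟩, one_dvd m⟩
    (fun x y h => ⟨⟨(posOn_mul.1 h.1.1).1, h.1.2.of_mul.1⟩, (Dvd.intro _ rfl).trans h.2⟩)
    ⟨mlen M m, fun x hx => mlen_le_of_dvd hx.2⟩ (by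
      intro w s t hst hs ht
      simp only [Set.mem_ofPred_eq, posOn_mul, posOn_sig] at hs ht ⊢
      exact ⟨⟨⟨hs.1.1.1, posOn_dihed hs.1.1.2 ht.1.1.2⟩, hs.1.2.mul_dihed hst ht.1.2⟩,
        mul_dihed_dvd hst hs.2 ht.2⟩)
  rw [← eq_garside hx.1.1 hx.1.2 fun s hs =>
    hmax _ ⟨⟨posOn_sig.2 hs, simple_sig s⟩, h s hs⟩]
  exact hx.2

theorem exists_eq_mul_garside {J : Set B} {m : Mon M} (h : ∀ s ∈ J, ∃ c, m = c * sig M s) :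
    ∃ c, m = c * garside M J := by
  rw [← mrev_dvd_mrev, mrev_garside]
  refine garside_dvd fun s hs => ?_
  rw [← mrev_sig, mrev_dvd_mrev]
  exact h s hs

variable (M) in
/-- A central element of the braid monoid: the square of the Garside element. -/
noncomputable def fullTwist : Mon M := garside M Set.univ * garside M Set.univ

theorem fullTwist_comm (a : Mon M) : fullTwist M * a = a * fullTwist M :=
  garside_mul_garside_comm (posOn_univ a)

theorem fullTwist_pow_comm (n : ℕ) (a : Mon M) : fullTwist M ^ n * a = a * fullTwist M ^ n :=
  (Commute.pow_left (fullTwist_comm a) n).eq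

theorem exists_mul_eq_fullTwist_pow (a : Mon M) : ∃ n c, a * c = fullTwist M ^ n := by
  obtain ⟨l, rfl⟩ := exists_wd M a
  induction l with
  | nil => exact ⟨0, 1, by rw [wd_nil, one_mul, pow_zero]⟩
  | cons s l ih =>
    obtain ⟨n, c, e⟩ := ih
    obtain ⟨f, hf⟩ := sig_dvd_garside (M := M) (Set.mem_univ s)
    refine ⟨n + 1, c * (f * garside M Set.univ), ?_⟩
    rw [wd_cons, mul_assoc, ← mul_assoc (wd M l), e, fullTwist_pow_comm, ← mul_assoc, ← mul_assoc,
      ← hf, pow_succ', fullTwist]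

theorem exists_mul_eq_fullTwist_pow' (a : Mon M) : ∃ n c, c * a = fullTwist M ^ n := by
  obtain ⟨n, c, e⟩ := exists_mul_eq_fullTwist_pow a
  refine ⟨n, c, mul_left_cancel (a := a) ?_⟩
  rw [← mul_assoc, e, fullTwist_pow_comm]

end Garside

section Embedding

variable (M : CoxeterMatrix B)

theorem prod_map_gen_altList (s t : B) (hst : s ≠ t) (h0 : M s t ≠ 0) :
    ((altList s t (M s t)).map (gen M)).prod = ((altList t s (M s t)).map (gen M)).prod := by
  have h : PresentedGroup.mk (braidRels M) _ = 1 :=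
    PresentedGroup.one_of_mem (rels := braidRels M) ⟨s, t, hst, h0, rfl⟩
  rw [map_mul, map_inv, mul_inv_eq_one, map_list_prod, map_list_prod, List.map_map,
    List.map_map] at h
  exact h

/-- The canonical map from the braid monoid to the Artin-Tits group. -/
def incl : Mon M →* Artin M := monLift M (gen M) (prod_map_gen_altList M)

variable {M}

@[simp] theorem incl_sig (s : B) : incl M (sig M s) = gen M s := by
  rw [sig, incl, monLift_wd]
  simp

theorem mem_posMonOn {X : Set B} {g : Artin M} :
    g ∈ posMonOn M X ↔ ∃ a, posOn X a ∧ incl M a = g := by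
  constructor
  · intro h
    induction h using Submonoid.closure_induction with
    | mem x hx =>
      obtain ⟨s, hs, rfl⟩ := hx
      exact ⟨sig M s, posOn_sig.2 hs, incl_sig s⟩
    | one => exact ⟨1, posOn_one X, map_one _⟩
    | mul x y _ _ hx hy =>
      obtain ⟨a, ha, rfl⟩ := hx
      obtain ⟨b, hb, rfl⟩ := hy
      exact ⟨a * b, posOn_mul.2 ⟨ha, hb⟩, map_mul _ _ _⟩
  · rintro ⟨a, ha, rfl⟩
    obtain ⟨l, rfl⟩ := exists_wd M a
    induction l with
    | nil => rw [wd_nil, map_one]; exact one_mem _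
    | cons s l ih =>
      rw [wd_cons, posOn_mul, posOn_sig] at ha
      rw [wd_cons, map_mul, incl_sig]
      exact mul_mem (Submonoid.subset_closure ⟨s, ha.1, rfl⟩) (ih ha.2)

theorem mem_posMon {g : Artin M} : g ∈ posMon M ↔ ∃ a, incl M a = g := by
  have : posMon M = posMonOn M Set.univ := by rw [posMon, posMonOn, Set.image_univ]
  rw [this, mem_posMonOn]
  simp [posOn_univ]

variable [Finite M.Group]

noncomputable instance : OreLocalization.OreSet (Submonoid.powers (fullTwist M)) where
  ore_right_cancel _ _ s h := ⟨s, by rw [mul_right_cancel h]⟩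
  oreNum r _ := r
  oreDenom _ s := s
  ore_eq r s := by
    obtain ⟨_, n, rfl⟩ := s
    exact fullTwist_pow_comm n r

theorem incl_injective : Function.Injective (incl M) := by
  let L := OreLocalization (Submonoid.powers (fullTwist M)) (Mon M)
  let ν : Mon M →* L := OreLocalization.numeratorHom
  have hν : Function.Injective ν := by
    intro a b h
    obtain ⟨u, v, h1, h2⟩ := OreLocalization.oreDiv_eq_iff.1 h
    rw [Submonoid.smul_def, smul_eq_mul, smul_eq_mul] at h1
    rw [OneMemClass.coe_one, mul_one, mul_one] at h2
    rw [h2] at h1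
    exact (mul_left_cancel h1).symm
  have hD : ∀ n, IsUnit (ν (fullTwist M ^ n)) := fun n =>
    OreLocalization.numerator_isUnit (⟨fullTwist M ^ n, n, rfl⟩ : Submonoid.powers (fullTwist M))
  have hu : ∀ a, IsUnit (ν a) := by
    intro a
    obtain ⟨n, c, h⟩ := exists_mul_eq_fullTwist_pow a
    obtain ⟨k, d, h'⟩ := exists_mul_eq_fullTwist_pow' a
    obtain ⟨x, hx⟩ := (hD n).exists_right_inv
    obtain ⟨y, hy⟩ := (hD k).exists_left_inv
    rw [← h, map_mul, mul_assoc] at hx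
    rw [← h', map_mul, ← mul_assoc] at hy
    exact isUnit_iff_exists_and_exists.2 ⟨⟨_, hx⟩, ⟨_, hy⟩⟩
  let υ : Mon M →* Lˣ := IsUnit.liftRight ν hu
  have hυ : ∀ a, (υ a : L) = ν a := IsUnit.coe_liftRight ν hu
  have hrel : ∀ r ∈ braidRels M, FreeGroup.lift (fun s => υ (sig M s)) r = 1 := by
    have hw : ∀ l : List B, FreeGroup.lift (fun s => υ (sig M s)) (l.map FreeGroup.of).prod =
        υ (wd M l) := by
      intro l
      induction l with
      | nil => rw [wd_nil, map_one, List.map_nil, List.prod_nil, map_one]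
      | cons s l ih =>
        rw [List.map_cons, List.prod_cons, map_mul, ih, wd_cons, map_mul, FreeGroup.lift_apply_of]
    rintro r ⟨s, t, hst, h0, rfl⟩
    rw [map_mul, map_inv, hw, hw, wd_altList_comm M s t h0, mul_inv_cancel]
  let θ : Artin M →* Lˣ := PresentedGroup.toGroup hrel
  have hcomp : ∀ a, θ (incl M a) = υ a := by
    intro a
    obtain ⟨l, rfl⟩ := exists_wd M a
    induction l with
    | nil => rw [wd_nil, map_one, map_one, map_one]
    | cons s l ih =>
      rw [wd_cons, map_mul, map_mul, map_mul, ← ih, incl_sig]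
      congr 1
      exact PresentedGroup.toGroup.of hrel
  intro a b h
  apply hν
  rw [← hυ, ← hυ, ← hcomp, ← hcomp, h]

theorem ldvd_incl {a b : Mon M} : ldvd M (incl M a) (incl M b) ↔ a ∣ b := by
  constructor
  · rintro ⟨c, hc, h⟩
    obtain ⟨c, rfl⟩ := mem_posMon.1 hc
    rw [← map_mul] at h
    exact ⟨c, (incl_injective h).symm⟩
  · rintro ⟨c, rfl⟩
    exact ⟨incl M c, mem_posMon.2 ⟨c, rfl⟩, (map_mul _ _ _).symm⟩

theorem lreduced_incl {X : Set B} {a : Mon M} : lreduced M X (incl M a) ↔ lred X a := by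
  simp only [lreduced, lred, ← incl_sig, ldvd_incl]

theorem isDelta_garside (J : Set B) : IsDelta M J (incl M (garside M J)) := by
  have key : ∀ (y m : Mon M), posOn J m → y ∣ m → ∃ c ∈ posMonOn M J, incl M y * c = incl M m := by
    rintro y _ hm ⟨c, rfl⟩
    exact ⟨incl M c, mem_posMonOn.2 ⟨c, (posOn_mul.1 hm).2, rfl⟩, (map_mul _ _ _).symm⟩
  refine ⟨mem_posMonOn.2 ⟨_, posOn_garside J, rfl⟩, fun s hs => ?_, fun m hm h => ?_⟩
  · rw [← incl_sig]
    exact key _ _ (posOn_garside J) (sig_dvd_garside hs)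
  · obtain ⟨m, hm', rfl⟩ := mem_posMonOn.1 hm
    refine key _ _ hm' (garside_dvd fun s hs => ?_)
    obtain ⟨c, hc, e⟩ := h s hs
    obtain ⟨c, -, rfl⟩ := mem_posMonOn.1 hc
    rw [← incl_sig, ← map_mul] at e
    exact ⟨c, (incl_injective e).symm⟩

end Embedding

section QuasiCentralizer

variable {M : CoxeterMatrix B} {X Y Z : Set B}

theorem mem_conjSet {g : Artin M} : g ∈ conjSet M X Y ↔
    (∀ x ∈ X, ∃ y ∈ Y, g * gen M x = gen M y * g) ∧
      ∀ y ∈ Y, ∃ x ∈ X, g * gen M x = gen M y * g := by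
  constructor
  · intro h
    have h : (fun x => g * gen M x) '' X = (fun x => gen M x * g) '' Y := h
    refine ⟨fun x hx => ?_, fun y hy => ?_⟩
    · obtain ⟨y, hy, e⟩ := h ▸ Set.mem_image_of_mem (fun x => g * gen M x) hx
      exact ⟨y, hy, e.symm⟩
    · have := Set.mem_image_of_mem (fun x => gen M x * g) hy
      rwa [← h] at this
  · rintro ⟨h1, h2⟩
    refine Set.Subset.antisymm ?_ ?_
    · rintro _ ⟨x, hx, rfl⟩
      obtain ⟨y, hy, e⟩ := h1 x hx
      exact ⟨y, hy, e.symm⟩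
    · rintro _ ⟨y, hy, rfl⟩
      exact h2 y hy

theorem one_mem_conjSet (X : Set B) : (1 : Artin M) ∈ conjSet M X X :=
  mem_conjSet.2 ⟨fun x hx => ⟨x, hx, by rw [one_mul, mul_one]⟩,
    fun x hx => ⟨x, hx, by rw [one_mul, mul_one]⟩⟩

theorem mul_mem_conjSet {g h : Artin M} (hg : g ∈ conjSet M Y Z) (hh : h ∈ conjSet M X Y) :
    g * h ∈ conjSet M X Z := by
  rw [mem_conjSet] at *
  refine ⟨fun x hx => ?_, fun z hz => ?_⟩
  · obtain ⟨y, hy, e⟩ := hh.1 x hx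
    obtain ⟨z, hz, e'⟩ := hg.1 y hy
    exact ⟨z, hz, by rw [mul_assoc, e, ← mul_assoc, e', mul_assoc]⟩
  · obtain ⟨y, hy, e⟩ := hg.2 z hz
    obtain ⟨x, hx, e'⟩ := hh.2 y hy
    exact ⟨x, hx, by rw [mul_assoc, e', ← mul_assoc, e, mul_assoc]⟩

theorem inv_mem_conjSet {g : Artin M} (hg : g ∈ conjSet M X Y) : g⁻¹ ∈ conjSet M Y X := by
  have key : ∀ x y, g * gen M x = gen M y * g → g⁻¹ * gen M y = gen M x * g⁻¹ := by
    intro x y e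
    rw [inv_mul_eq_iff_eq_mul, ← mul_assoc, e, mul_inv_cancel_right]
  rw [mem_conjSet] at *
  refine ⟨fun y hy => ?_, fun x hx => ?_⟩
  · obtain ⟨x, hx, e⟩ := hg.2 y hy
    exact ⟨x, hx, key x y e⟩
  · obtain ⟨y, hy, e⟩ := hg.1 x hx
    exact ⟨y, hy, key x y e⟩

theorem conj_mem_stdSub {g z : Artin M} (hg : g ∈ conjSet M X Y) (hz : z ∈ stdSub M X) :
    g * z * g⁻¹ ∈ stdSub M Y := by
  induction hz using Subgroup.closure_induction with
  | mem z hz =>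
    obtain ⟨x, hx, rfl⟩ := hz
    obtain ⟨y, hy, e⟩ := (mem_conjSet.1 hg).1 x hx
    rw [e, mul_inv_cancel_right]
    exact Subgroup.subset_closure ⟨y, hy, rfl⟩
  | one => rw [mul_one, mul_inv_cancel]; exact one_mem _
  | mul a b _ _ ha hb => simpa [mul_assoc] using mul_mem ha hb
  | inv a _ ha => simpa [mul_assoc] using inv_mem ha

theorem stdSub_univ : stdSub M Set.univ = ⊤ := by
  rw [stdSub, Set.image_univ]
  exact PresentedGroup.closure_range_of _

theorem incl_mem_stdSub {a : Mon M} (ha : posOn X a) : incl M a ∈ stdSub M X := by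
  obtain ⟨l, rfl⟩ := exists_wd M a
  induction l with
  | nil => rw [wd_nil, map_one]; exact one_mem _
  | cons s l ih =>
    rw [wd_cons, posOn_mul, posOn_sig] at ha
    rw [wd_cons, map_mul, incl_sig]
    exact mul_mem (Subgroup.subset_closure ⟨s, ha.1, rfl⟩) (ih ha.2)

variable [Finite M.Group]

theorem incl_mem_conjSet {a : Mon M} : incl M a ∈ conjSet M X Y ↔
    (∀ x ∈ X, ∃ y ∈ Y, a * sig M x = sig M y * a) ∧
      ∀ y ∈ Y, ∃ x ∈ X, a * sig M x = sig M y * a := by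
  simp only [mem_conjSet, ← incl_sig, ← map_mul, incl_injective.eq_iff]

theorem exists_mul_eq_incl {a : Artin M} (ha : a ∈ stdSub M X) :
    ∃ d b, posOn X d ∧ posOn X b ∧ incl M d * a = incl M b := by
  induction ha using Subgroup.closure_induction_right with
  | one => exact ⟨1, 1, posOn_one X, posOn_one X, by rw [map_one, one_mul]⟩
  | mul_right a _ y hy ih =>
    obtain ⟨s, hs, rfl⟩ := hy
    obtain ⟨d, b, hd, hb, e⟩ := ih
    exact ⟨d, b * sig M s, hd, posOn_mul.2 ⟨hb, posOn_sig.2 hs⟩, by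
      rw [← mul_assoc, e, map_mul, incl_sig]⟩
  | mul_inv_cancel a _ y hy ih =>
    obtain ⟨s, hs, rfl⟩ := hy
    obtain ⟨d, b, hd, hb, e⟩ := ih
    obtain ⟨f, hf⟩ := exists_eq_mul_sig_of_mem (M := M) hs
    have hg := posOn_garside (M := M) X
    have hf' := hg
    rw [hf, posOn_mul] at hf'
    refine ⟨garside M X * garside M X * d, b * (garside M X * f),
      posOn_mul.2 ⟨posOn_mul.2 ⟨hg, hg⟩, hd⟩, posOn_mul.2 ⟨hb, posOn_mul.2 ⟨hg, hf'.1⟩⟩, ?_⟩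
    rw [← mul_assoc, mul_inv_eq_iff_eq_mul, map_mul, mul_assoc (incl M _), e, ← map_mul,
      garside_mul_garside_comm hb, ← incl_sig, ← map_mul, mul_assoc, mul_assoc, ← hf]

theorem incl_fullTwist_pow_comm (n : ℕ) (g : Artin M) :
    incl M (fullTwist M ^ n) * g = g * incl M (fullTwist M ^ n) := by
  have h : stdSub M Set.univ ≤ Subgroup.centralizer {incl M (fullTwist M ^ n)} := by
    refine (Subgroup.closure_le _).2 ?_
    rintro _ ⟨s, -, rfl⟩
    refine Subgroup.mem_centralizer_singleton_iff.2 ?_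
    rw [← incl_sig, ← map_mul, ← map_mul, fullTwist_pow_comm]
  rw [stdSub_univ] at h
  exact (Subgroup.mem_centralizer_singleton_iff.1 (h (Subgroup.mem_top g))).symm

theorem incl_fullTwist_pow_mem_conjSet (n : ℕ) : incl M (fullTwist M ^ n) ∈ conjSet M X X :=
  mem_conjSet.2 ⟨fun x hx => ⟨x, hx, incl_fullTwist_pow_comm n _⟩,
    fun x hx => ⟨x, hx, incl_fullTwist_pow_comm n _⟩⟩

theorem exists_fullTwist_pow_mul_eq_incl (g : Artin M) :
    ∃ n b, incl M (fullTwist M ^ n) * g = incl M b := by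
  obtain ⟨d, b, -, -, e⟩ := exists_mul_eq_incl (X := Set.univ) (a := g)
    (by rw [stdSub_univ]; exact Subgroup.mem_top g)
  obtain ⟨n, c, hc⟩ := exists_mul_eq_fullTwist_pow' d
  exact ⟨n, c * b, by rw [← hc, map_mul, mul_assoc, e, map_mul]⟩

theorem exists_posOn_mul_comm {p z : Mon M} (hp : incl M p ∈ conjSet M X Y) (hz : posOn X z) :
    ∃ w, posOn Y w ∧ p * z = w * p := by
  obtain ⟨l, rfl⟩ := exists_wd M z
  induction l with
  | nil => exact ⟨1, posOn_one Y, by rw [wd_nil, one_mul, mul_one]⟩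
  | cons s l ih =>
    rw [wd_cons, posOn_mul, posOn_sig] at hz
    obtain ⟨w, hw, e⟩ := ih hz.2
    obtain ⟨y, hy, e'⟩ := (incl_mem_conjSet.1 hp).1 s hz.1
    exact ⟨sig M y * w, posOn_mul.2 ⟨posOn_sig.2 hy, hw⟩, by
      rw [wd_cons, ← mul_assoc, e', mul_assoc, e, mul_assoc]⟩

theorem lred_mul {p q : Mon M} (hp : incl M p ∈ conjSet M X Y) (hp' : lred Y p)
    (hq : lred X q) : lred Y (p * q) := by
  intro s hs h
  obtain ⟨t, ht, e⟩ := (incl_mem_conjSet.1 hp).2 s hs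
  exact hq t ht (sig_dvd_of_sig_dvd_mul (hp' s hs) e.symm h)

theorem eq_one_of_mul_incl_eq {a : Artin M} (ha : a ∈ stdSub M X) {p q : Mon M}
    (hp : lred X p) (hq : lred X q) (h : a * incl M p = incl M q) : a = 1 := by
  obtain ⟨d, b, hd, hb, e⟩ := exists_mul_eq_incl ha
  have : b * p = d * q := by
    apply incl_injective
    rw [map_mul, map_mul, ← e, mul_assoc, h]
  rw [(eq_of_mul_lred_eq hb hd hp hq this).1] at e
  exact mul_eq_left.1 e

theorem exists_eq_mul_of_mem_conjSet [Finite B] {m : Mon M} (hm : incl M m ∈ conjSet M X X) :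
    ∃ z h, posOn X z ∧ lred X h ∧ m = z * h ∧
      incl M z ∈ conjSet M X X ∧ incl M h ∈ conjSet M X X := by
  obtain ⟨z, h, hz, hh, rfl⟩ := exists_eq_mul_lred X m
  have key : ∀ x ∈ X, ∃ y ∈ X, h * sig M x = sig M y * h := by
    intro x hx
    obtain ⟨t, ht, e⟩ := (incl_mem_conjSet.1 hm).1 x hx
    obtain ⟨y, k, hy, hk, e'⟩ := exists_eq_mul_lred X (h * sig M x)
    rw [mul_assoc, e', ← mul_assoc, ← mul_assoc] at e
    have hkh := (eq_of_mul_lred_eq (posOn_mul.2 ⟨hz, hy⟩)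
      (posOn_mul.2 ⟨posOn_sig.2 ht, hz⟩) hk hh e).2
    rw [hkh] at e'
    have hl := congrArg (mlen M) e'
    rw [mlen_mul, mlen_mul, mlen_sig] at hl
    obtain ⟨s, rfl⟩ := exists_eq_sig (a := y) (by omega)
    exact ⟨s, posOn_sig.1 hy, e'⟩
  choose! f hf hfe using key
  have hinj : Function.Injective (fun x : X => (⟨f x, hf x x.2⟩ : X)) := by
    rintro ⟨x, hx⟩ ⟨y, hy⟩ e
    have := hfe x hx
    rw [Subtype.mk.inj e, ← hfe y hy] at this
    exact Subtype.ext (sig_injective (mul_left_cancel this))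
  have hc : incl M h ∈ conjSet M X X := incl_mem_conjSet.2
    ⟨fun x hx => ⟨f x, hf x hx, hfe x hx⟩, fun y hy => by
      obtain ⟨⟨x, hx⟩, e⟩ := Finite.surjective_of_injective hinj ⟨y, hy⟩
      exact ⟨x, hx, by rw [hfe x hx, Subtype.mk.inj e]⟩⟩
  refine ⟨z, h, hz, hh, rfl, ?_, hc⟩
  rw [map_mul] at hm
  simpa using mul_mem_conjSet hm (inv_mem_conjSet hc)

theorem exists_mul_eq_mul [Finite B] {p q : Mon M} (hp : incl M p ∈ conjSet M X X)
    (hp' : lred X p) (hq : incl M q ∈ conjSet M X X) (hq' : lred X q) :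
    ∃ r s, (incl M r ∈ conjSet M X X ∧ lred X r) ∧ (incl M s ∈ conjSet M X X ∧ lred X s) ∧
      p * r = q * s := by
  obtain ⟨n, c, hc⟩ := exists_mul_eq_fullTwist_pow p
  obtain ⟨k, d, hd⟩ := exists_mul_eq_fullTwist_pow q
  have key : ∀ {p c : Mon M} {n : ℕ} (k : ℕ), incl M p ∈ conjSet M X X →
      p * c = fullTwist M ^ n → ∃ w r, posOn X w ∧ (incl M r ∈ conjSet M X X ∧ lred X r) ∧
        fullTwist M ^ n * fullTwist M ^ k = w * (p * r) := by
    intro p c n k hp hc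
    have hm : incl M (c * fullTwist M ^ k) ∈ conjSet M X X := by
      have := mul_mem_conjSet (inv_mem_conjSet hp)
        (incl_fullTwist_pow_mem_conjSet (M := M) (X := X) (n + k))
      rwa [pow_add, ← hc, map_mul, map_mul, mul_assoc, inv_mul_cancel_left, ← map_mul] at this
    obtain ⟨z, r, hz, hr, e, -, hr'⟩ := exists_eq_mul_of_mem_conjSet hm
    obtain ⟨w, hw, e'⟩ := exists_posOn_mul_comm hp hz
    exact ⟨w, r, hw, ⟨hr', hr⟩, by rw [← hc, mul_assoc, e, ← mul_assoc, e', mul_assoc]⟩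
  obtain ⟨w, r, hw, hr, e⟩ := key k hp hc
  obtain ⟨v, s, hv, hs, e'⟩ := key n hq hd
  rw [← pow_add] at e e'
  rw [add_comm, e] at e'
  exact ⟨r, s, hr, hs, (eq_of_mul_lred_eq hw hv (lred_mul hp hp' hr.2)
    (lred_mul hq hq' hs.2) e').2⟩

end QuasiCentralizer

section Ribbons

variable {M : CoxeterMatrix B} {X Y Z : Set B}

theorem IsElemRibbon.mem_conjSet {g : Artin M} (h : IsElemRibbon M X Y g) :
    g ∈ conjSet M X Y := by
  obtain ⟨t, -, -, -, h⟩ := h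
  exact h.symm

theorem IsRibbon.mem_conjSet {g : Artin M} (h : IsRibbon M X Y g) : g ∈ conjSet M X Y := by
  induction h with
  | nil => exact one_mem_conjSet _
  | cons _ h ih => exact mul_mem_conjSet h.mem_conjSet ih

theorem IsRibbon.prepend {g h : Artin M} (hh : IsRibbon M Y Z h) (hg : IsElemRibbon M X Y g) :
    IsRibbon M X Z (h * g) := by
  induction hh with
  | nil => simpa using IsRibbon.cons (.nil X) hg
  | cons _ hk ih =>
    rw [mul_assoc]
    exact .cons ih hk

theorem sig_mul_sig_comm {s t : B} (h : M s t = 2) :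
    sig M s * sig M t = sig M t * sig M s := by
  have := wd_altList_comm M s t (by rw [h]; exact two_ne_zero)
  rw [h] at this
  simpa [altList, wd_cons, wd_nil] using this

theorem sig_mul_comm {s : B} (h : ∀ t ∈ X, M s t = 2) {a : Mon M} (ha : posOn X a) :
    a * sig M s = sig M s * a := by
  obtain ⟨l, rfl⟩ := exists_wd M a
  induction l with
  | nil => rw [wd_nil, one_mul, mul_one]
  | cons t l ih =>
    rw [wd_cons, posOn_mul, posOn_sig] at ha
    rw [wd_cons, mul_assoc, ih ha.2, ← mul_assoc, ← sig_mul_sig_comm (h t ha.1), mul_assoc]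

variable [Finite M.Group]

theorem isDelta_iff {J : Set B} {d : Artin M} : IsDelta M J d ↔ d = incl M (garside M J) := by
  refine ⟨fun ⟨h1, h2, h3⟩ => ?_, fun h => h ▸ isDelta_garside J⟩
  obtain ⟨b, -, rfl⟩ := mem_posMonOn.1 h1
  obtain ⟨g1, g2, -⟩ := isDelta_garside (M := M) J
  obtain ⟨c, hc, e⟩ := h3 _ g1 g2
  obtain ⟨c, -, rfl⟩ := mem_posMonOn.1 hc
  rw [← map_mul] at e
  refine congrArg _ (dvd_antisymm_mon ⟨c, (incl_injective e).symm⟩ (garside_dvd fun s hs => ?_))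
  obtain ⟨c, hc, e⟩ := h2 s hs
  obtain ⟨c, -, rfl⟩ := mem_posMonOn.1 hc
  rw [← incl_sig, ← map_mul] at e
  exact ⟨c, (incl_injective e).symm⟩

theorem exists_garside_eq_mul_garside {J K : Set B} (h : J ⊆ K) :
    ∃ d : Mon M, garside M K = d * garside M J :=
  exists_eq_mul_garside fun _ hs => exists_eq_mul_sig_of_mem (h hs)

theorem IsElemRibbon.exists_incl {g : Artin M} (h : IsElemRibbon M X Y g) :
    ∃ a, incl M a = g := by
  obtain ⟨t, -, ⟨-, h⟩ | ⟨-, d₁, d₂, h₁, h₂, rfl⟩, -⟩ := h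
  · exact ⟨_, (isDelta_iff.1 h).symm⟩
  · obtain ⟨d, hd⟩ := exists_garside_eq_mul_garside (M := M)
      (Set.sdiff_subset (s := comp M (X ∪ {t}) t) (t := {t}))
    exact ⟨d, by rw [isDelta_iff.1 h₁, isDelta_iff.1 h₂, hd, map_mul, mul_inv_cancel_right]⟩

theorem IsRibbon.exists_incl {g : Artin M} (h : IsRibbon M X Y g) : ∃ a, incl M a = g := by
  induction h with
  | nil => exact ⟨1, map_one _⟩
  | cons _ h ih =>
    obtain ⟨a, rfl⟩ := ih
    obtain ⟨b, rfl⟩ := h.exists_incl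
    exact ⟨b * a, map_mul _ _ _⟩

/-- The elementary ribbon attached to a letter outside of `X`. -/
theorem exists_isElemRibbon {t : B} (ht : t ∉ X) {d : Mon M}
    (hd : garside M (comp M (X ∪ {t}) t) = d * garside M (comp M (X ∪ {t}) t \ {t})) :
    ∃ Y, IsElemRibbon M X Y (incl M d) := by
  set K := comp M (X ∪ {t}) t with hK
  have hdK : posOn K d := by
    have := posOn_garside (M := M) K
    rw [hd] at this
    exact (posOn_mul.1 this).1
  have key : ∀ x ∈ X, ∃ y ∈ X ∪ {t}, d * sig M x = sig M y * d := by
    intro x hx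
    by_cases hxK : x ∈ K
    · obtain ⟨w, hw, e⟩ := exists_sig_mul_garside (M := M) (J := K \ {t})
        (⟨hxK, fun h => ht (h ▸ hx)⟩ : x ∈ K \ {t})
      obtain ⟨y, hy, e'⟩ := exists_garside_mul_sig (M := M) hw.1
      refine ⟨y, hy.1, mul_right_cancel (b := garside M (K \ {t})) ?_⟩
      rw [mul_assoc, e, ← mul_assoc, ← hd, e', hd, mul_assoc]
    · refine ⟨x, .inl hx, sig_mul_comm (fun z hz => ?_) hdK⟩
      by_contra h2
      refine hxK ⟨.inl hx, hz.2.tail ⟨hz.1, .inl hx, ?_, ?_⟩⟩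
      · rintro rfl
        exact hxK hz
      · rwa [M.symmetric]
  have hfin : IsSpherical M K := by
    unfold IsSpherical
    infer_instance
  refine ⟨{y | y ∈ X ∪ {t} ∧ ∃ x ∈ X, d * sig M x = sig M y * d}, t, hfin, .inr ⟨ht, _, _,
    isDelta_garside K, isDelta_garside (K \ {t}), ?_⟩, fun y hy => hy.1, ?_⟩
  · rw [hd, map_mul, mul_inv_cancel_right]
  · refine (incl_mem_conjSet.2 ⟨fun x hx => ?_, fun y hy => hy.2⟩ :
      incl M d ∈ conjSet M X _).symm
    obtain ⟨y, hy, e⟩ := key x hx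
    exact ⟨y, ⟨hy, x, hx, e⟩, e⟩

theorem isRibbon_of_mem_conjSet {h : Mon M} (hc : incl M h ∈ conjSet M X Y) (hr : lred Y h) :
    IsRibbon M X Y (incl M h) := by
  induction hn : mlen M h using Nat.strong_induction_on generalizing h X with
  | _ n ih =>
  have hc' := incl_mem_conjSet.1 hc
  by_cases h1 : h = 1
  · subst h1
    have : X = Y := by
      simp only [one_mul, mul_one, sig_injective.eq_iff] at hc'
      refine Set.Subset.antisymm (fun x hx => ?_) fun y hy => ?_
      · obtain ⟨y, hy, rfl⟩ := hc'.1 x hx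
        exact hy
      · obtain ⟨x, hx, rfl⟩ := hc'.2 y hy
        exact hx
    rw [this, map_one]
    exact .nil Y
  obtain ⟨h₀, t, e⟩ := exists_mul_sig h1
  have ht : t ∉ X := by
    intro ht
    obtain ⟨y, hy, e'⟩ := hc'.1 t ht
    nth_rw 2 [e] at e'
    rw [← mul_assoc] at e'
    exact hr y hy ⟨h₀, mul_right_cancel e'⟩
  set K := comp M (X ∪ {t}) t with hK
  have htK : t ∈ K := ⟨.inr rfl, .refl⟩
  have hJX : K \ {t} ⊆ X := fun s hs => hs.1.1.resolve_right hs.2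
  obtain ⟨d, hd⟩ := exists_garside_eq_mul_garside (M := M) (Set.sdiff_subset (s := K) (t := {t}))
  have hdiv : ∃ c, h * garside M (K \ {t}) = c * garside M K := by
    refine exists_eq_mul_garside fun s hs => ?_
    by_cases hst : s = t
    · obtain ⟨w, -, e'⟩ := exists_posOn_mul_comm hc (posOn_mono hJX (posOn_garside (M := M) _))
      exact ⟨w * h₀, by rw [e', hst, mul_assoc, ← e]⟩
    · obtain ⟨c, e'⟩ := exists_eq_mul_sig_of_mem (M := M) (show s ∈ K \ {t} from ⟨hs, hst⟩)
      exact ⟨h * c, by rw [mul_assoc, ← e']⟩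
  obtain ⟨c, hcd⟩ := hdiv
  rw [hd, ← mul_assoc] at hcd
  have hcd := mul_right_cancel hcd
  obtain ⟨Z, hZ⟩ := exists_isElemRibbon ht hd
  have hd1 : 0 < mlen M d := by
    refine Nat.pos_of_ne_zero fun h0 => ?_
    rw [eq_one_of_mlen_eq_zero h0, one_mul] at hd
    obtain ⟨f, hf⟩ := sig_dvd_garside (M := M) htK
    have := posOn_garside (M := M) (K \ {t})
    rw [← hd, hf, posOn_mul, posOn_sig] at this
    exact this.1.2 rfl
  have hcc : incl M c ∈ conjSet M Z Y := by
    have := mul_mem_conjSet hc (inv_mem_conjSet hZ.mem_conjSet)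
    rwa [hcd, map_mul, mul_inv_cancel_right] at this
  rw [hcd, mlen_mul] at hn
  rw [hcd, map_mul]
  exact (ih _ (by omega) hcc (fun s hs h' => hr s hs (hcd ▸ h'.mul_right d)) rfl).prepend hZ

theorem mem_HXset {g : Artin M} : g ∈ HXset M X ↔
    ∃ p q, (incl M p ∈ conjSet M X X ∧ lred X p) ∧ (incl M q ∈ conjSet M X X ∧ lred X q) ∧
      g = incl M p * (incl M q)⁻¹ := by
  constructor
  · rintro ⟨g₁, g₂, h₁, r₁, h₂, r₂, rfl⟩
    obtain ⟨p, rfl⟩ := h₁.exists_incl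
    obtain ⟨q, rfl⟩ := h₂.exists_incl
    exact ⟨p, q, ⟨h₁.mem_conjSet, lreduced_incl.1 r₁⟩, ⟨h₂.mem_conjSet, lreduced_incl.1 r₂⟩, rfl⟩
  · rintro ⟨p, q, ⟨h₁, r₁⟩, ⟨h₂, r₂⟩, rfl⟩
    exact ⟨_, _, isRibbon_of_mem_conjSet h₁ r₁, lreduced_incl.2 r₁,
      isRibbon_of_mem_conjSet h₂ r₂, lreduced_incl.2 r₂, rfl⟩

theorem eq_one_of_mul_eq_of_mem_HXset [Finite B] {a h h' : Artin M} (ha : a ∈ stdSub M X)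
    (hh : h ∈ HXset M X) (hh' : h' ∈ HXset M X) (e : a * h = h') : a = 1 := by
  obtain ⟨p, q, hp, hq, rfl⟩ := mem_HXset.1 hh
  obtain ⟨p', q', hp', hq', rfl⟩ := mem_HXset.1 hh'
  obtain ⟨r, s, hr, hs, e'⟩ := exists_mul_eq_mul hq.1 hq.2 hq'.1 hq'.2
  refine eq_one_of_mul_incl_eq ha (lred_mul hp.1 hp.2 hr.2) (lred_mul hp'.1 hp'.2 hs.2) ?_
  have h2 := congrArg (incl M) e'
  rw [map_mul, map_mul] at h2
  rw [map_mul, map_mul]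
  calc a * (incl M p * incl M r)
      = a * (incl M p * (incl M q)⁻¹) * (incl M q * incl M r) := by group
    _ = incl M p' * (incl M q')⁻¹ * (incl M q' * incl M s) := by rw [e, h2]
    _ = incl M p' * incl M s := by group

theorem one_mem_HXset : (1 : Artin M) ∈ HXset M X := by
  refine ⟨1, 1, .nil X, ?_, .nil X, ?_, by rw [inv_one, mul_one]⟩ <;>
  · rw [← map_one (incl M), lreduced_incl]
    intro s _ h
    have := mlen_le_of_dvd h
    simp at this

theorem exists_eq_mul_mem_HXset [Finite B] {g : Artin M} (hg : g ∈ QZset M X) :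
    ∃ z h, (z ∈ stdSub M X ∧ z ∈ QZset M X) ∧ h ∈ HXset M X ∧ g = z * h := by
  obtain ⟨n, m, e⟩ := exists_fullTwist_pow_mul_eq_incl g
  have hτ := incl_fullTwist_pow_mem_conjSet (M := M) (X := X) n
  obtain ⟨z₁, h₁, hz₁, r₁, rfl, cz₁, ch₁⟩ :=
    exists_eq_mul_of_mem_conjSet (e ▸ mul_mem_conjSet hτ hg)
  obtain ⟨z₂, h₂, hz₂, r₂, e₂, cz₂, ch₂⟩ := exists_eq_mul_of_mem_conjSet hτ
  rw [incl_fullTwist_pow_comm, e₂, map_mul, map_mul] at e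
  set h := incl M h₁ * (incl M h₂)⁻¹ with hh
  have ch : h ∈ conjSet M X X := mul_mem_conjSet ch₁ (inv_mem_conjSet ch₂)
  refine ⟨incl M z₁ * (h * (incl M z₂)⁻¹ * h⁻¹), h, ⟨?_, ?_⟩,
    mem_HXset.2 ⟨h₁, h₂, ⟨ch₁, r₁⟩, ⟨ch₂, r₂⟩, rfl⟩, ?_⟩
  · exact mul_mem (incl_mem_stdSub hz₁) (conj_mem_stdSub ch (inv_mem (incl_mem_stdSub hz₂)))
  · exact mul_mem_conjSet cz₁ (mul_mem_conjSet (mul_mem_conjSet ch (inv_mem_conjSet cz₂))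
      (inv_mem_conjSet ch))
  · rw [eq_mul_inv_of_mul_eq e, hh]
    group

end Ribbons

/-- **Proposition (Godelle).** In a spherical-type Artin-Tits system,
`QZ_{A_S}(A_X) = QZ_{A_X}(A_X) ⋊ H_X`: every `g ∈ QZ_{A_S}(A_X)` writes uniquely
`g = z·h` with `z ∈ QZ_{A_X}(A_X)` and `h ∈ H_X`, the intersection is trivial, and
`QZ_{A_X}(A_X)` is normal in `QZ_{A_S}(A_X)`. -/
theorem quasicentralizer_semidirect
    [Finite B] (M : CoxeterMatrix B) (hsph : Finite M.Group) (X : Set B) :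
    (∀ g ∈ QZset M X, ∃! zh : Artin M × Artin M,
        (zh.1 ∈ stdSub M X ∧ zh.1 ∈ QZset M X) ∧ zh.2 ∈ HXset M X ∧ g = zh.1 * zh.2) ∧
    ({a : Artin M | a ∈ stdSub M X ∧ a ∈ QZset M X} ∩ HXset M X = {1}) ∧
    (∀ g ∈ QZset M X, ∀ z : Artin M, z ∈ stdSub M X ∧ z ∈ QZset M X →
        g * z * g⁻¹ ∈ stdSub M X ∧ g * z * g⁻¹ ∈ QZset M X) := by
  refine ⟨fun g hg => ?_, ?_, fun g hg z hz => ⟨conj_mem_stdSub hg hz.1,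
    mul_mem_conjSet (mul_mem_conjSet hg hz.2) (inv_mem_conjSet hg)⟩⟩
  · obtain ⟨z, h, hz, hh, e⟩ := exists_eq_mul_mem_HXset hg
    refine ⟨(z, h), ⟨hz, hh, e⟩, ?_⟩
    rintro ⟨z', h'⟩ ⟨hz', hh', e'⟩
    have hm : z⁻¹ * z' * h' = h := by rw [mul_assoc, ← e', e, inv_mul_cancel_left]
    have h1 : z = z' := inv_mul_eq_one.1
      (eq_one_of_mul_eq_of_mem_HXset (mul_mem (inv_mem hz.1) hz'.1) hh' hh hm)
    subst h1
    rw [inv_mul_cancel, one_mul] at hm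
    rw [hm]
  · refine Set.Subset.antisymm ?_ ?_
    · rintro a ⟨ha, hh⟩
      exact eq_one_of_mul_eq_of_mem_HXset ha.1 one_mem_HXset hh (mul_one a)
    · rintro _ rfl
      exact ⟨⟨one_mem _, one_mem_conjSet X⟩, one_mem_HXset⟩

end ArtinTitsPaper
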